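/- arXiv:1707.08109 — 2 statements merged into one kernel-verified Lean document; each statement's English description precedes it below -/
import Mathlib

section
/- There exists a non-computable left-c.e. real α in (0,1) such that every prefix-free machine M with Ω_M = α has a computable (decidable) domain. -/
open scoped Classical

/-- A set of binary strings is prefix-free if no element is a proper prefix of another. -/
def PrefixFreeSet (D : Set (List Bool)) : Prop :=
  ∀ σ ∈ D, ∀ τ ∈ D, σ <+: τ → σ = τ

/-- A prefix-free machine: a partial computable function on binary strings
whose domain is prefix-free. -/
structure PFMachine where
  f : List Bool →. List Bool
  partrec : Partrec f
  prefixFree : PrefixFreeSet {σ | (f σ).Dom}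

/-- The halting probability `Ω_M = Σ_{σ ∈ dom M} 2^{-|σ|}` of a prefix-free machine. -/
noncomputable def omegaOf (M : PFMachine) : ℝ :=
  ∑' σ : {σ : List Bool // (M.f σ).Dom}, (2 : ℝ) ^ (-(σ.1.length : ℤ))

/-- A computable nondecreasing sequence of rationals converging to `x`. -/
def LeftCEApprox (q : ℕ → ℚ) (x : ℝ) : Prop :=
  Computable q ∧ Monotone q ∧
    Filter.Tendsto (fun n => (q n : ℝ)) Filter.atTop (nhds x)

/-- A real is left-c.e. if some computable nondecreasing rational sequence converges to it. -/
def LeftCE (x : ℝ) : Prop := ∃ q : ℕ → ℚ, LeftCEApprox q x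

/-- A real is right-c.e. if its negative is left-c.e. -/
def RightCE (x : ℝ) : Prop := LeftCE (-x)

/-- Martin-Löf randomness of a real, via computable sequences of open rational intervals. -/
def MLRandom (x : ℝ) : Prop :=
  ∀ I : ℕ → ℕ → ℚ × ℚ, Computable₂ I →
    (∀ n : ℕ, MeasureTheory.volume
        (⋃ k : ℕ, Set.Ioo (((I n k).1 : ℝ)) (((I n k).2 : ℝ))) ≤ 2 ^ (-(n : ℤ))) →
    x ∉ ⋂ n : ℕ, ⋃ k : ℕ, Set.Ioo (((I n k).1 : ℝ)) (((I n k).2 : ℝ))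

/-- A universal prefix-free machine: it simulates every prefix-free machine
via a fixed prefix. -/
def UniversalPF (U : PFMachine) : Prop :=
  ∀ M : PFMachine, ∃ ρ : List Bool, ∀ σ : List Bool, U.f (ρ ++ σ) = M.f σ

/-- The `i`-th binary digit of a real (of its expansion not ending in all 1s). -/
noncomputable def rdigit (x : ℝ) (i : ℕ) : Bool := decide (⌊x * 2 ^ (i + 1)⌋ % 2 = 1)

/-- The first `n` binary digits of a real. -/
noncomputable def bits (x : ℝ) (n : ℕ) : List Bool := (List.range n).map (rdigit x)

/-- Prefix-free Kolmogorov complexity of `σ` with respect to machine `M`,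
with value `⊤` if `σ` is not in the range. -/
noncomputable def Kf (M : PFMachine) (σ : List Bool) : ℕ∞ :=
  ⨅ p : {p : List Bool // σ ∈ M.f p}, (p.1.length : ℕ∞)

/-- An optimal prefix-free machine: minimizes `K` up to additive constants. -/
def OptimalPF (V : PFMachine) : Prop :=
  ∀ M : PFMachine, ∃ c : ℕ, ∀ σ : List Bool, Kf V σ ≤ Kf M σ + c

/-- Solovay reducibility for left-c.e. reals. -/
def SolovayRed (α β : ℝ) : Prop :=
  ∃ c : ℚ, ∃ f : ℚ →. ℚ, Partrec f ∧
    ∀ q : ℚ, (q : ℝ) < β →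
      ∃ r ∈ f q, (r : ℝ) < α ∧ α - (r : ℝ) < (c : ℝ) * (β - (q : ℝ))

/-- `X` is computable from `Y` with oracle-use `h`. -/
def ComputableFromWithUse (X Y : ℝ) (h : ℕ → ℕ) : Prop :=
  ∃ Φ : List Bool →. List Bool, Partrec Φ ∧
    ∀ n : ℕ, Φ (bits Y (h n)) = Part.some (bits X n)


/-- A real is computable if both it and its negative are left-c.e. -/
def ComputableReal (x : ℝ) : Prop := LeftCE x ∧ LeftCE (-x)

theorem primrec_two_pow : Primrec fun n : ℕ => 2 ^ n := by
  refine (Primrec.nat_rec₁ (f := fun _ m => m * 2) 1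
    (Primrec.nat_mul.comp Primrec.snd (Primrec.const 2)).to₂).of_eq fun n => ?_
  induction n with
  | zero => rfl
  | succ n ih => simp only [ih, pow_succ]

/-- A nonnegative real-valued function given by primitive recursive numerators and denominators. -/
def PrimrecReal {α : Type*} [Primcodable α] (r : α → ℝ) : Prop :=
  ∃ n d : α → ℕ, Primrec n ∧ Primrec d ∧ ∀ a, 0 < d a ∧ r a = n a / d a

namespace PrimrecReal

variable {α β : Type*} [Primcodable α] [Primcodable β]

theorem natCast {f : α → ℕ} (hf : Primrec f) : PrimrecReal fun a => (f a : ℝ) :=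
  ⟨f, fun _ => 1, hf, .const 1, fun a => by simp⟩

theorem comp {r : α → ℝ} (hr : PrimrecReal r) {f : β → α} (hf : Primrec f) :
    PrimrecReal fun b => r (f b) := by
  obtain ⟨n, d, hn, hd, h⟩ := hr
  exact ⟨_, _, hn.comp hf, hd.comp hf, fun b => h (f b)⟩

theorem div_natCast {r : α → ℝ} (hr : PrimrecReal r) {f : α → ℕ} (hf : Primrec f)
    (hpos : ∀ a, 0 < f a) : PrimrecReal fun a => r a / f a := by
  obtain ⟨n, d, hn, hd, h⟩ := hr
  refine ⟨n, fun a => d a * f a, hn, Primrec.nat_mul.comp hd hf,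
    fun a => ⟨Nat.mul_pos (h a).1 (hpos a), ?_⟩⟩
  simp only [(h a).2]
  push_cast
  rw [div_div]

theorem add {r s : α → ℝ} (hr : PrimrecReal r) (hs : PrimrecReal s) :
    PrimrecReal fun a => r a + s a := by
  obtain ⟨n, d, hn, hd, h⟩ := hr
  obtain ⟨n', d', hn', hd', h'⟩ := hs
  refine ⟨fun a => n a * d' a + n' a * d a, fun a => d a * d' a,
    Primrec.nat_add.comp (Primrec.nat_mul.comp hn hd') (Primrec.nat_mul.comp hn' hd),
    Primrec.nat_mul.comp hd hd', fun a => ⟨Nat.mul_pos (h a).1 (h' a).1, ?_⟩⟩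
  have h1 : (d a : ℝ) ≠ 0 := by exact_mod_cast (h a).1.ne'
  have h2 : (d' a : ℝ) ≠ 0 := by exact_mod_cast (h' a).1.ne'
  simp only [(h a).2, (h' a).2]
  push_cast
  field_simp

theorem ite {c : α → Prop} [DecidablePred c] {r s : α → ℝ} (hc : PrimrecPred c) (hr : PrimrecReal r)
    (hs : PrimrecReal s) : PrimrecReal fun a => if c a then r a else s a := by
  obtain ⟨n, d, hn, hd, h⟩ := hr
  obtain ⟨n', d', hn', hd', h'⟩ := hs
  refine ⟨_, _, Primrec.ite hc hn hn', Primrec.ite hc hd hd', fun a => ?_⟩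
  by_cases hca : c a
  · simpa [hca] using h a
  · simpa [hca] using h' a

theorem lt {r s : α → ℝ} (hr : PrimrecReal r) (hs : PrimrecReal s) :
    PrimrecPred fun a => r a < s a := by
  obtain ⟨n, d, hn, hd, h⟩ := hr
  obtain ⟨n', d', hn', hd', h'⟩ := hs
  refine (Primrec.nat_lt.comp (Primrec.nat_mul.comp hn hd') (Primrec.nat_mul.comp hn' hd)).of_eq
    fun a => ?_
  have h1 : (0 : ℝ) < d a := by exact_mod_cast (h a).1
  have h2 : (0 : ℝ) < d' a := by exact_mod_cast (h' a).1
  rw [(h a).2, (h' a).2, div_lt_div_iff₀ h1 h2]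
  exact_mod_cast Iff.rfl

theorem one_div_two_pow {f : α → ℕ} (hf : Primrec f) :
    PrimrecReal fun a => (1 / 2 : ℝ) ^ f a :=
  ⟨fun _ => 1, fun a => 2 ^ f a, .const 1, primrec_two_pow.comp hf,
    fun a => ⟨by positivity, by simp⟩⟩

theorem sum_range {r : α → ℕ → ℝ} (hr : PrimrecReal fun p : α × ℕ => r p.1 p.2) {f : α → ℕ}
    (hf : Primrec f) : PrimrecReal fun a => ∑ k ∈ Finset.range (f a), r a k := by
  obtain ⟨n, d, hn, hd, h⟩ := hr
  let F : α → ℕ → ℕ × ℕ := fun a m =>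
    Nat.rec (0, 1) (fun k q => (q.1 * d (a, k) + n (a, k) * q.2, q.2 * d (a, k))) m
  have hF : Primrec fun a => F a (f a) := by
    have hk : Primrec fun x : α × ℕ × ℕ × ℕ => (x.1, x.2.1) :=
      Primrec.fst.pair (Primrec.fst.comp Primrec.snd)
    have hq1 : Primrec fun x : α × ℕ × ℕ × ℕ => x.2.2.1 :=
      Primrec.fst.comp (Primrec.snd.comp Primrec.snd)
    have hq2 : Primrec fun x : α × ℕ × ℕ × ℕ => x.2.2.2 :=
      Primrec.snd.comp (Primrec.snd.comp Primrec.snd)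
    exact Primrec.nat_rec' (h := fun a kq => (kq.2.1 * d (a, kq.1) + n (a, kq.1) * kq.2.2,
        kq.2.2 * d (a, kq.1))) hf (.const (0, 1))
      (Primrec.pair (Primrec.nat_add.comp (Primrec.nat_mul.comp hq1 (hd.comp hk))
          (Primrec.nat_mul.comp (hn.comp hk) hq2))
        (Primrec.nat_mul.comp hq2 (hd.comp hk))).to₂
  refine ⟨_, _, Primrec.fst.comp hF, Primrec.snd.comp hF, fun a => ?_⟩
  beta_reduce
  generalize f a = m
  induction m with
  | zero => simp [F]
  | succ m ih =>
    have h1 : (0 : ℝ) < (F a m).2 := by exact_mod_cast ih.1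
    have h2 : (0 : ℝ) < d (a, m) := by exact_mod_cast (h (a, m)).1
    refine ⟨Nat.mul_pos ih.1 (h (a, m)).1, ?_⟩
    have hr' : r a m = n (a, m) / d (a, m) := (h (a, m)).2
    rw [Finset.sum_range_succ, ih.2, hr']
    change _ = (((F a m).1 * d (a, m) + n (a, m) * (F a m).2 : ℕ) : ℝ) /
      (((F a m).2 * d (a, m) : ℕ) : ℝ)
    push_cast
    field_simp

end PrimrecReal

section Rationals

open Encodable

/-- The natural numbers that code a pair of an integer numerator and a coprime positive
denominator. -/
theorem mem_range_encode_rat (y : ℕ) : y ∈ Set.range (@encode ℚ Rat.instEncodable) ↔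
    0 < y.unpair.2 ∧ Nat.Coprime (y.unpair.1.bodd.toNat + y.unpair.1.div2) y.unpair.2 := by
  have key : ∀ q : ℚ, @encode ℚ Rat.instEncodable q = Nat.pair (encode q.num) q.den := fun _ => rfl
  have hz : ∀ z : ℤ, (encode z).bodd.toNat + (encode z).div2 = z.natAbs := by
    rintro (n | n)
    · change (2 * n).bodd.toNat + (2 * n).div2 = n
      simp [Nat.div2_val]
    · change (2 * n + 1).bodd.toNat + (2 * n + 1).div2 = n + 1
      simp [Nat.div2_val]; omega
  constructor
  · rintro ⟨q, rfl⟩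
    rw [key]
    simp only [Nat.unpair_pair, hz]
    exact ⟨q.den_pos, q.reduced⟩
  · rintro ⟨h1, h2⟩
    let z := Denumerable.ofNat ℤ y.unpair.1
    have hzy : encode z = y.unpair.1 := Denumerable.encode_ofNat _
    rw [← hzy, hz] at h2
    refine ⟨⟨z, y.unpair.2, h1.ne', h2⟩, ?_⟩
    rw [key]
    simp only [hzy, Nat.pair_unpair]

theorem primrecPred_mem_range_encode_rat :
    PrimrecPred fun y => y ∈ Set.range (@encode ℚ Rat.instEncodable) := by
  have hfst : Primrec fun y : ℕ => y.unpair.1 := Primrec.fst.comp Primrec.unpair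
  have hsnd : Primrec fun y : ℕ => y.unpair.2 := Primrec.snd.comp Primrec.unpair
  have hdvd : PrimrecRel fun a b : ℕ => a ∣ b :=
    (Primrec.eq.comp (Primrec.nat_mod.comp Primrec.snd Primrec.fst) (Primrec.const 0)).of_eq
      fun _ => (Nat.dvd_iff_mod_eq_zero).symm
  have hcop : PrimrecRel fun a b : ℕ => ∀ x < b + 1, ¬ x ∣ b ∨ ¬ x ∣ a ∨ x = 1 := by
    have hx : PrimrecRel fun (x : ℕ) (p : ℕ × ℕ) => ¬ x ∣ p.2 ∨ ¬ x ∣ p.1 ∨ x = 1 :=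
      (hdvd.comp Primrec.fst (Primrec.snd.comp Primrec.snd)).not.or
        ((hdvd.comp Primrec.fst (Primrec.fst.comp Primrec.snd)).not.or
          (Primrec.eq.comp Primrec.fst (Primrec.const 1)))
    have hall : PrimrecRel fun (L : List ℕ) (p : ℕ × ℕ) =>
        ∀ x ∈ L, ¬ x ∣ p.2 ∨ ¬ x ∣ p.1 ∨ x = 1 := PrimrecRel.forall_mem_list hx
    refine (hall.comp (Primrec.list_range.comp (Primrec.succ.comp Primrec.snd))
      Primrec.id).of_eq fun p => ?_
    simp
  have hbd : Primrec fun y : ℕ => y.unpair.1.bodd.toNat + y.unpair.1.div2 := by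
    refine Primrec.nat_add.comp ?_ (Primrec.nat_div2.comp hfst)
    exact (Primrec.dom_bool Bool.toNat).comp (Primrec.nat_bodd.comp hfst)
  refine ((Primrec.nat_lt.comp (.const 0) hsnd).and (hcop.comp hbd hsnd)).of_eq fun y => ?_
  rw [mem_range_encode_rat]
  refine and_congr_right fun hy => ⟨fun h => ?_, fun h x _ => ?_⟩
  · have hg := h _ (Nat.lt_succ_of_le (Nat.gcd_le_right (y.unpair.1.bodd.toNat + y.unpair.1.div2) hy))
    rcases hg with hg | hg | hg
    · exact absurd (Nat.gcd_dvd_right _ _) hg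
    · exact absurd (Nat.gcd_dvd_left _ _) hg
    · exact hg
  · by_cases h1 : x ∣ y.unpair.2
    · by_cases h2 : x ∣ y.unpair.1.bodd.toNat + y.unpair.1.div2
      · exact .inr (.inr (Nat.eq_one_of_dvd_coprimes h h2 h1))
      · exact .inr (.inl h2)
    · exact .inl h1

/-- The code of a rational in `Primcodable ℚ` is the rank of its code as a coprime pair. -/
theorem encode_rat_eq_length (q : ℚ) :
    @encode ℚ Rat.instDenumerable.toEncodable q =
      ((List.range (@encode ℚ Rat.instEncodable q)).filter
        (fun y => decide (y ∈ Set.range (@encode ℚ Rat.instEncodable)))).length := by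
  rw [← List.countP_eq_length_filter]
  have h : @encode ℚ Rat.instDenumerable.toEncodable q =
      @List.countP ℕ (fun y => @decide (y ∈ Set.range (@encode ℚ Rat.instEncodable))
        (@Encodable.decidableRangeEncode ℚ Rat.instEncodable y))
        (List.range (@encode ℚ Rat.instEncodable q)) := rfl
  rw [h]
  congr!

/-- The rank of a natural number in the set of codes of rationals as coprime pairs. -/
noncomputable def ratRank (y : ℕ) : ℕ :=
  ((List.range y).filter (fun y => decide (y ∈ Set.range (@encode ℚ Rat.instEncodable)))).length

theorem primrec_ratRank : Primrec ratRank := by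
  have h := primrecPred_mem_range_encode_rat
  have h2 := (Primrec.listFilter h).comp Primrec.list_range
  exact (Primrec.list_length.comp h2).of_eq fun y => by unfold ratRank; congr!

theorem exists_computable_choice {α : Type*} [Primcodable α] {P : α → ℕ → Prop}
    (hP : ComputablePred fun p : α × ℕ => P p.1 p.2) (hex : ∀ a, ∃ y, P a y) :
    ∃ f : α → ℕ, Computable f ∧ ∀ a, P a (f a) :=
  ⟨_, Computable.find hP hex, fun a => by convert Nat.find_spec (hex a)⟩

theorem abs_encode_rat (q : ℚ) :
    (@encode ℚ Rat.instEncodable q).unpair.1.bodd.toNat +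
      (@encode ℚ Rat.instEncodable q).unpair.1.div2 = q.num.natAbs := by
  change (Nat.pair (encode q.num) q.den).unpair.1.bodd.toNat + (Nat.pair (encode q.num) q.den).unpair.1.div2 = _
  simp only [Nat.unpair_pair]
  generalize q.num = z
  rcases z with n | n
  · change (2 * n).bodd.toNat + (2 * n).div2 = n
    simp [Nat.div2_val]
  · change (2 * n + 1).bodd.toNat + (2 * n + 1).div2 = n + 1
    simp [Nat.div2_val]; omega

theorem den_encode_rat (q : ℚ) : (@encode ℚ Rat.instEncodable q).unpair.2 = q.den := by
  change (Nat.pair (encode q.num) q.den).unpair.2 = _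
  simp

theorem bodd_encode_rat (q : ℚ) :
    (@encode ℚ Rat.instEncodable q).unpair.1.bodd = false ↔ 0 ≤ q.num := by
  change (Nat.pair (encode q.num) q.den).unpair.1.bodd = false ↔ _
  simp only [Nat.unpair_pair]
  generalize q.num = z
  rcases z with n | n
  · change (2 * n).bodd = false ↔ _
    simp
  · change (2 * n + 1).bodd = false ↔ _
    simp

/-- A primitive recursive real is a computable rational. -/
theorem PrimrecReal.exists_computable_rat {α : Type*} [Primcodable α] {r : α → ℝ}
    (hr : PrimrecReal r) : ∃ q : α → ℚ, Computable q ∧ ∀ a, (q a : ℝ) = r a := by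
  obtain ⟨n, d, hn, hd, h⟩ := hr
  refine ⟨fun a => (n a : ℚ) / d a, ?_, fun a => by rw [(h a).2]; push_cast; rfl⟩
  let P : α → ℕ → Prop := fun a y => y ∈ Set.range (@encode ℚ Rat.instEncodable) ∧
    y.unpair.1.bodd = false ∧ (y.unpair.1.bodd.toNat + y.unpair.1.div2) * d a = n a * y.unpair.2
  have huniq : ∀ a (q : ℚ), P a (@encode ℚ Rat.instEncodable q) ↔ q = (n a : ℚ) / d a := by
    intro a q
    have hd0 : (d a : ℚ) ≠ 0 := by exact_mod_cast (h a).1.ne'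
    simp only [P, Set.mem_range_self, true_and, bodd_encode_rat, abs_encode_rat, den_encode_rat]
    rw [eq_div_iff hd0]
    have hq : q = q.num / q.den := (Rat.num_div_den q).symm
    have hdq : (q.den : ℚ) ≠ 0 := by exact_mod_cast q.den_pos.ne'
    have hiff : q * d a = n a ↔ q.num * (d a : ℤ) = n a * q.den := by
      rw [hq, div_mul_eq_mul_div, div_eq_iff hdq, ← hq]
      exact_mod_cast Iff.rfl
    rw [hiff]
    constructor
    · rintro ⟨h1, h2⟩
      rw [← Int.natAbs_of_nonneg h1]
      exact_mod_cast h2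
    · intro h1
      have h0 : 0 ≤ q.num := by
        have : 0 ≤ q.num * (d a : ℤ) := by rw [h1]; positivity
        exact nonneg_of_mul_nonneg_left this (by exact_mod_cast (h a).1)
      refine ⟨h0, ?_⟩
      rw [← Int.natAbs_of_nonneg h0] at h1
      exact_mod_cast h1
  have hex : ∀ a, ∃ y, P a y := fun a => ⟨_, (huniq a _).2 rfl⟩
  have hP : ComputablePred fun p : α × ℕ => P p.1 p.2 := by
    have hy : Primrec fun p : α × ℕ => p.2.unpair := Primrec.unpair.comp Primrec.snd
    have hy1 := Primrec.fst.comp hy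
    have hy2 := Primrec.snd.comp hy
    have hb := Primrec.nat_bodd.comp hy1
    refine PrimrecPred.computablePred ((primrecPred_mem_range_encode_rat.comp Primrec.snd).and
      ((Primrec.eq.comp hb (.const false)).and (Primrec.eq.comp
        (Primrec.nat_mul.comp (Primrec.nat_add.comp ((Primrec.dom_bool Bool.toNat).comp hb)
          (Primrec.nat_div2.comp hy1)) (hd.comp Primrec.fst))
        (Primrec.nat_mul.comp (hn.comp Primrec.fst) hy2))))
  obtain ⟨f, hf, hs⟩ := exists_computable_choice hP hex
  refine Computable.encode_iff.1 ((primrec_ratRank.to_comp.comp hf).of_eq fun a => ?_)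
  obtain ⟨q, hq⟩ := (hs a).1
  have h1 := hs a
  rw [← hq, huniq] at h1
  rw [← hq, h1]
  exact (encode_rat_eq_length _).symm

theorem computable_of_encode_rat {g : ℕ → ℕ} (hg : Primrec g) :
    Computable fun q : ℚ => g (@encode ℚ Rat.instEncodable q) := by
  let P : ℚ → ℕ → Prop := fun q y => y ∈ Set.range (@encode ℚ Rat.instEncodable) ∧
    ratRank y = @encode ℚ Rat.instDenumerable.toEncodable q
  have huniq : ∀ q q' : ℚ, P q (@encode ℚ Rat.instEncodable q') ↔ q' = q := by
    intro q q'
    simp only [P, Set.mem_range_self, true_and]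
    rw [← (@Encodable.encode_injective ℚ Rat.instDenumerable.toEncodable).eq_iff,
      encode_rat_eq_length q']
    rfl
  have hex : ∀ a, ∃ y, P a y := fun a => ⟨_, (huniq a _).2 rfl⟩
  have hP : ComputablePred fun p : ℚ × ℕ => P p.1 p.2 :=
    PrimrecPred.computablePred ((primrecPred_mem_range_encode_rat.comp Primrec.snd).and
      (Primrec.eq.comp (primrec_ratRank.comp Primrec.snd) (Primrec.encode.comp Primrec.fst)))
  obtain ⟨f, hf, hs⟩ := exists_computable_choice hP hex
  refine (hg.to_comp.comp hf).of_eq fun q => ?_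
  obtain ⟨q', hq⟩ := (hs q).1
  have h1 := hs q
  rw [← hq, huniq] at h1
  rw [← hq, h1]

theorem computable_rat_natAbs_num : Computable fun q : ℚ => q.num.natAbs := by
  have hy1 : Primrec fun y : ℕ => y.unpair.1 := Primrec.fst.comp Primrec.unpair
  exact (computable_of_encode_rat (Primrec.nat_add.comp ((Primrec.dom_bool Bool.toNat).comp
    (Primrec.nat_bodd.comp hy1)) (Primrec.nat_div2.comp hy1))).of_eq abs_encode_rat

theorem computable_rat_den : Computable fun q : ℚ => q.den :=
  (computable_of_encode_rat (Primrec.snd.comp Primrec.unpair)).of_eq den_encode_rat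

end Rationals

section Construction

open Nat.Partrec (Code)

/-- Within `t` steps the `i`-th program on input `x` halts with an output at most `t`. -/
def HaltsBy (i x t : ℕ) : Prop := ∃ y ∈ Code.evaln t (Denumerable.ofNat Code i) x, y ≤ t

/-- The harmonic weight of the part of the interval `[a, b)` on which `O` is true. -/
noncomputable def weight (O : ℕ → Bool) (a b : ℕ) : ℝ :=
  ∑ t ∈ Finset.Ico a b, if O t then 1 / ((t : ℝ) + 1) else 0

/-- The state of a gate at a stage: the number `v` of completed rounds and the stage `u` at which
the current round began. A round is completed once the weight of `O` since `u` has reached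
`1 / (v + 1)` and the `i`-th program has halted on `u`. -/
noncomputable def gate (i : ℕ) (O : ℕ → Bool) : ℕ → ℕ × ℕ
  | 0 => (0, 0)
  | t + 1 =>
    if ¬ weight O (gate i O t).2 t < 1 / (((gate i O t).1 : ℝ) + 1) ∧ HaltsBy i (gate i O t).2 t
    then ((gate i O t).1 + 1, t + 1) else gate i O t

/-- A gate is open at a stage if the weight allotted to the current round is not exhausted. -/
def GateOpen (i : ℕ) (O : ℕ → Bool) (t : ℕ) : Prop :=
  weight O (gate i O t).2 t < 1 / (((gate i O t).1 : ℝ) + 1)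

/-- The stages available to a strategy `l`; the head of `l` is its guess about the gate of
index `l.tail.length`. -/
noncomputable def avail : List Bool → ℕ → Bool
  | [], _ => true
  | true :: l, t => avail l t && decide (GateOpen l.length (avail l) t)
  | false :: l, t => avail l t

/-- The number of rounds completed by the gate following the strategy `l`. -/
noncomputable def rounds (l : List Bool) (t : ℕ) : ℕ := (gate l.length (avail l) t).1

/-- The total number of rounds completed by the gates that `l` guesses to be bounded. -/
noncomputable def injury : List Bool → ℕ → ℕ
  | [], _ => 0
  | true :: l, t => injury l t
  | false :: l, t => injury l t + rounds l t

/-- The strategy of a requirement `c`. -/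
def strat (c : ℕ) : List Bool := (Encodable.decode c.unpair.1).getD []

/-- The requirement `c` wants to act at stage `t`. -/
noncomputable def wants (c t : ℕ) : Bool :=
  decide (Nat.pair (Encodable.encode (strat c)) (injury (strat c) t) = c) && avail (strat c) t &&
    decide (HaltsBy (strat c).length c t)

/-- The requirement `c` acts at stage `t`. -/
noncomputable def acts (c t : ℕ) : Bool := wants c t && decide (weight (wants c) 0 t < 1)

/-- The approximations to the constructed real. -/
noncomputable def approx (s : ℕ) : ℝ :=
  ∑ t ∈ Finset.range s, ∑ c ∈ Finset.range t,
    (if acts c t then 1 / ((t : ℝ) + 1) else 0) * (1 / 2) ^ (c + 3)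

end Construction

section Computability

open Nat.Partrec (Code)

variable {α : Type*} [Primcodable α]

theorem primrecPred_haltsBy {f g h : α → ℕ} (hf : Primrec f) (hg : Primrec g) (hh : Primrec h) :
    PrimrecPred fun a => HaltsBy (f a) (g a) (h a) := by
  have he : Primrec fun a => Code.evaln (h a) (Denumerable.ofNat Code (f a)) (g a) :=
    Code.primrec_evaln.comp ((hh.pair ((Primrec.ofNat Code).comp hf)).pair hg)
  have hR : PrimrecRel fun (y : ℕ) (o : Option ℕ) => o = some y :=
    Primrec.eq.comp Primrec.snd (Primrec.option_some.comp Primrec.fst)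
  have hR' : PrimrecRel fun (L : List ℕ) (o : Option ℕ) => ∃ y ∈ L, o = some y :=
    PrimrecRel.exists_mem_list hR
  refine (hR'.comp (Primrec.list_range.comp (Primrec.succ.comp hh)) he).of_eq fun a => ?_
  simp only [List.mem_range, Nat.lt_succ_iff, HaltsBy, Option.mem_def]
  exact exists_congr fun y => and_comm

theorem primrecReal_weight {O : α → ℕ → Bool} (hO : Primrec₂ O) {f g : α → ℕ} (hf : Primrec f)
    (hg : Primrec g) : PrimrecReal fun a => weight (O a) (f a) (g a) := by
  have h1 : PrimrecReal fun p : α × ℕ =>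
      if f p.1 ≤ p.2 ∧ O p.1 p.2 = true then (1 : ℝ) / ((p.2 + 1 : ℕ) : ℝ) else 0 := by
    refine PrimrecReal.ite ((Primrec.nat_le.comp (hf.comp Primrec.fst) Primrec.snd).and
      (Primrec.eq.comp hO (.const true))) ?_ ?_
    · simpa using (PrimrecReal.natCast (α := α × ℕ) (.const 1)).div_natCast
        (Primrec.succ.comp Primrec.snd) fun _ => Nat.succ_pos _
    · simpa using PrimrecReal.natCast (α := α × ℕ) (.const 0)
  have h2 := PrimrecReal.sum_range (r := fun a t =>
    if f a ≤ t ∧ O a t = true then (1 : ℝ) / ((t + 1 : ℕ) : ℝ) else 0) h1 hg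
  refine (congrArg PrimrecReal (funext fun a => ?_)).mp h2
  have h3 : Finset.Ico (f a) (g a) = (Finset.range (g a)).filter (f a ≤ ·) := by
    ext; simp [and_comm]
  rw [weight, h3, Finset.sum_filter]
  refine Finset.sum_congr rfl fun t _ => ?_
  by_cases h4 : f a ≤ t <;> simp [h4]

theorem primrec_gate {i t : α → ℕ} {O : α → ℕ → Bool} (hi : Primrec i) (ht : Primrec t)
    (hO : Primrec₂ O) : Primrec fun a => gate (i a) (O a) (t a) := by
  let h : α → ℕ × (ℕ × ℕ) → ℕ × ℕ := fun a p =>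
    if ¬ weight (O a) p.2.2 p.1 < 1 / ((p.2.1 : ℝ) + 1) ∧ HaltsBy (i a) p.2.2 p.1
    then (p.2.1 + 1, p.1 + 1) else p.2
  have hh : Primrec₂ h := by
    have hk : Primrec fun x : α × ℕ × ℕ × ℕ => x.2.1 := Primrec.fst.comp Primrec.snd
    have hv : Primrec fun x : α × ℕ × ℕ × ℕ => x.2.2.1 :=
      Primrec.fst.comp (Primrec.snd.comp Primrec.snd)
    have hu : Primrec fun x : α × ℕ × ℕ × ℕ => x.2.2.2 :=
      Primrec.snd.comp (Primrec.snd.comp Primrec.snd)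
    have hw : PrimrecReal fun x : α × ℕ × ℕ × ℕ => weight (O x.1) x.2.2.2 x.2.1 :=
      primrecReal_weight (O := fun x : α × ℕ × ℕ × ℕ => O x.1)
        (hO.comp (Primrec.fst.comp Primrec.fst) Primrec.snd) hu hk
    have hq : PrimrecReal fun x : α × ℕ × ℕ × ℕ => 1 / ((x.2.2.1 : ℝ) + 1) := by
      simpa using (PrimrecReal.natCast (α := α × ℕ × ℕ × ℕ) (.const 1)).div_natCast
        (Primrec.succ.comp hv) fun _ => Nat.succ_pos _
    exact Primrec.ite ((hw.lt hq).not.and (primrecPred_haltsBy (hi.comp Primrec.fst) hu hk))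
      ((Primrec.succ.comp hv).pair (Primrec.succ.comp hk)) (Primrec.snd.comp Primrec.snd)
  refine (Primrec.nat_rec' ht (.const (0, 0)) hh).of_eq fun a => ?_
  generalize t a = s
  induction s with
  | zero => rfl
  | succ s ih =>
    simp only [gate]
    rw [← ih]

theorem weight_congr {O O' : ℕ → Bool} {a b : ℕ} (h : ∀ t < b, O t = O' t) :
    weight O a b = weight O' a b :=
  Finset.sum_congr rfl fun t ht => by rw [h t (Finset.mem_Ico.1 ht).2]

theorem gate_congr {i : ℕ} {O O' : ℕ → Bool} {t : ℕ} (h : ∀ s < t, O s = O' s) :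
    gate i O t = gate i O' t := by
  induction t with
  | zero => rfl
  | succ t ih =>
    have h' : ∀ s < t, O s = O' s := fun s hs => h s (Nat.lt_succ_of_lt hs)
    simp only [gate]
    rw [ih h', weight_congr h']

theorem gateOpen_congr {i : ℕ} {O O' : ℕ → Bool} {t : ℕ} (h : ∀ s < t, O s = O' s) :
    GateOpen i O t ↔ GateOpen i O' t := by
  rw [GateOpen, GateOpen, gate_congr h, weight_congr h]

theorem primrecPred_gateOpen {i t : α → ℕ} {O : α → ℕ → Bool} (hi : Primrec i) (ht : Primrec t)
    (hO : Primrec₂ O) : PrimrecPred fun a => GateOpen (i a) (O a) (t a) := by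
  have hg := primrec_gate hi ht hO
  refine PrimrecReal.lt (primrecReal_weight hO (Primrec.snd.comp hg) ht) ?_
  simpa using (PrimrecReal.natCast (α := α) (.const 1)).div_natCast
        (Primrec.succ.comp (Primrec.fst.comp hg)) fun _ => Nat.succ_pos _

theorem getD_map_range {β : Type*} (f : ℕ → β) (d : β) {s t : ℕ} (h : t < s) :
    ((List.range s).map f).getD t d = f t := by
  simp [h]

theorem primrec_map_avail : Primrec₂ fun (l : List Bool) (s : ℕ) => (List.range s).map (avail l) := by
  let h : List Bool × ℕ → Bool × List Bool × List Bool → List Bool := fun p q =>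
    (List.range p.2).map fun t => if q.1 = true then q.2.2.getD t false &&
      decide (GateOpen q.2.1.length (fun s => q.2.2.getD s false) t) else q.2.2.getD t false
  have hh : Primrec₂ h := by
    let γ := (List Bool × ℕ) × Bool × List Bool × List Bool
    refine Primrec.list_map (Primrec.list_range.comp (Primrec.snd.comp Primrec.fst)) ?_
    have hq : Primrec fun x : γ × ℕ => x.1.2 := Primrec.snd.comp Primrec.fst
    have hL : Primrec fun x : γ × ℕ => x.1.2.2.2 := Primrec.snd.comp (Primrec.snd.comp hq)
    have hg : Primrec fun x : γ × ℕ => x.1.2.2.2.getD x.2 false :=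
      (Primrec.list_getD false).comp hL Primrec.snd
    refine Primrec.ite (Primrec.eq.comp (Primrec.fst.comp hq) (.const true)) ?_ hg
    refine Primrec.and.comp hg (PrimrecPred.decide (primrecPred_gateOpen
      (Primrec.list_length.comp (Primrec.fst.comp (Primrec.snd.comp hq))) Primrec.snd ?_))
    exact (Primrec.list_getD false).comp (hL.comp Primrec.fst) Primrec.snd
  refine (Primrec.list_rec (f := fun p : List Bool × ℕ => p.1)
    (g := fun p => (List.range p.2).map (avail [])) (h := h) Primrec.fst ?_ hh).of_eq ?_
  · exact Primrec.list_map (Primrec.list_range.comp Primrec.snd) (.const true)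
  · rintro ⟨l, s⟩
    dsimp only
    induction l with
    | nil => rfl
    | cons b l ih =>
      simp only [ih, h]
      refine List.map_congr_left fun t ht => ?_
      have ht := List.mem_range.1 ht
      rw [getD_map_range _ _ ht]
      cases b
      · rfl
      · rw [if_pos rfl, avail]
        congr 2
        exact propext (gateOpen_congr fun r hr => getD_map_range _ _ (hr.trans ht))

theorem primrec_avail : Primrec₂ avail :=
  ((Primrec.list_getD false).comp
    (primrec_map_avail.comp Primrec.fst (Primrec.succ.comp Primrec.snd)) Primrec.snd).of_eq
    fun p => getD_map_range _ _ p.2.lt_succ_self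

theorem primrec_rounds : Primrec₂ rounds :=
  Primrec.fst.comp (primrec_gate (α := List Bool × ℕ) (i := fun p => p.1.length)
    (O := fun p => avail p.1)
    (Primrec.list_length.comp Primrec.fst) Primrec.snd
    (primrec_avail.comp (Primrec.fst.comp Primrec.fst) Primrec.snd))

theorem primrec_injury : Primrec₂ injury := by
  let h : List Bool × ℕ → Bool × List Bool × ℕ → ℕ := fun p q =>
    if q.1 = true then q.2.2 else q.2.2 + rounds q.2.1 p.2
  have hh : Primrec₂ h := by
    have hD : Primrec fun x : (List Bool × ℕ) × Bool × List Bool × ℕ => x.2.2.2 :=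
      Primrec.snd.comp (Primrec.snd.comp Primrec.snd)
    exact Primrec.ite (Primrec.eq.comp (Primrec.fst.comp Primrec.snd) (.const true)) hD
      (Primrec.nat_add.comp hD (primrec_rounds.comp
        (Primrec.fst.comp (Primrec.snd.comp Primrec.snd)) (Primrec.snd.comp Primrec.fst)))
  refine (Primrec.list_rec (f := fun p : List Bool × ℕ => p.1) (g := fun _ => 0) (h := h)
    Primrec.fst (.const 0) hh).of_eq ?_
  rintro ⟨l, s⟩
  dsimp only
  induction l with
  | nil => rfl
  | cons b l ih =>
    simp only [ih, h]
    cases b <;> simp [injury]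

theorem primrec_strat : Primrec strat :=
  Primrec.option_getD.comp (Primrec.decode.comp (Primrec.fst.comp Primrec.unpair)) (.const [])

theorem primrec_wants : Primrec₂ wants := by
  have hl : Primrec fun p : ℕ × ℕ => strat p.1 := primrec_strat.comp Primrec.fst
  refine Primrec.and.comp (Primrec.and.comp (PrimrecPred.decide (Primrec.eq.comp
    (Primrec₂.natPair.comp (Primrec.encode.comp hl) (primrec_injury.comp hl Primrec.snd))
    Primrec.fst)) (primrec_avail.comp hl Primrec.snd)) (PrimrecPred.decide ?_)
  exact primrecPred_haltsBy (Primrec.list_length.comp hl) Primrec.fst Primrec.snd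

theorem primrec_acts : Primrec₂ acts := by
  refine Primrec.and.comp primrec_wants (PrimrecPred.decide (PrimrecReal.lt ?_ ?_))
  · exact primrecReal_weight (O := fun p : ℕ × ℕ => wants p.1)
      (primrec_wants.comp (Primrec.fst.comp Primrec.fst) Primrec.snd) (.const 0) Primrec.snd
  · simpa using PrimrecReal.natCast (α := ℕ × ℕ) (.const 1)

theorem primrecReal_approx : PrimrecReal approx := by
  have h1 : PrimrecReal fun p : (ℕ × ℕ) × ℕ =>
      (if acts p.2 p.1.2 then 1 / ((p.1.2 : ℝ) + 1) else 0) * (1 / 2) ^ (p.2 + 3) := by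
    have h2 : Primrec fun p : (ℕ × ℕ) × ℕ => p.1.2 := Primrec.snd.comp Primrec.fst
    have h3 : PrimrecReal fun p : (ℕ × ℕ) × ℕ => (1 / 2 : ℝ) ^ (p.2 + 3) :=
      PrimrecReal.one_div_two_pow (Primrec.nat_add.comp Primrec.snd (.const 3))
    have h4 : PrimrecReal fun p : (ℕ × ℕ) × ℕ => (1 / 2 : ℝ) ^ (p.2 + 3) / ((p.1.2 + 1 : ℕ) : ℝ) :=
      h3.div_natCast (Primrec.succ.comp h2) fun _ => Nat.succ_pos _
    have h5 : PrimrecReal fun p : (ℕ × ℕ) × ℕ => (0 : ℝ) := by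
      simpa using PrimrecReal.natCast (α := (ℕ × ℕ) × ℕ) (.const 0)
    have h6 : Primrec fun p : (ℕ × ℕ) × ℕ => acts p.2 p.1.2 := primrec_acts.comp Primrec.snd h2
    refine (congrArg PrimrecReal (funext fun p => ?_)).mp
      (PrimrecReal.ite (Primrec.eq.comp h6 (.const true)) h4 h5)
    split_ifs
    · push_cast; ring
    · ring
  have h2 := PrimrecReal.sum_range (α := ℕ × ℕ) (r := fun p c =>
    (if acts c p.2 then 1 / ((p.2 : ℝ) + 1) else 0) * (1 / 2) ^ (c + 3)) h1 Primrec.snd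
  exact PrimrecReal.sum_range (α := ℕ) (r := fun _ t => ∑ c ∈ Finset.range t,
    (if acts c t then 1 / ((t : ℝ) + 1) else 0) * (1 / 2) ^ (c + 3)) h2 Primrec.id

end Computability

section Weight

variable {O O' : ℕ → Bool} {a b c : ℕ}

theorem weight_nonneg (O : ℕ → Bool) (a b : ℕ) : 0 ≤ weight O a b :=
  Finset.sum_nonneg fun t _ => by split_ifs <;> positivity

theorem weight_self (O : ℕ → Bool) (a : ℕ) : weight O a a = 0 := by simp [weight]

theorem weight_add (O : ℕ → Bool) (h1 : a ≤ b) (h2 : b ≤ c) :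
    weight O a b + weight O b c = weight O a c :=
  Finset.sum_Ico_consecutive _ h1 h2

theorem weight_succ (O : ℕ → Bool) (h : a ≤ b) :
    weight O a (b + 1) = weight O a b + if O b then 1 / ((b : ℝ) + 1) else 0 :=
  Finset.sum_Ico_succ_top h _

theorem weight_mono_right (O : ℕ → Bool) (a : ℕ) (h : b ≤ c) : weight O a b ≤ weight O a c :=
  Finset.sum_le_sum_of_subset_of_nonneg (Finset.Ico_subset_Ico_right h)
    fun t _ _ => by split_ifs <;> positivity

theorem weight_anti_left (O : ℕ → Bool) (c : ℕ) (h : a ≤ b) : weight O b c ≤ weight O a c :=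
  Finset.sum_le_sum_of_subset_of_nonneg (Finset.Ico_subset_Ico_left h)
    fun t _ _ => by split_ifs <;> positivity

theorem weight_mono (h : ∀ t, a ≤ t → t < b → O t = true → O' t = true) :
    weight O a b ≤ weight O' a b := by
  refine Finset.sum_le_sum fun t ht => ?_
  have ht := Finset.mem_Ico.1 ht
  have := h t ht.1 ht.2
  by_cases h1 : O t = true
  · simp [h1, this h1]
  · simp only [h1]
    split_ifs <;> simp_all; positivity

theorem weight_le_add_of_threshold {θ : ℝ} (hθ : 0 ≤ θ) (hab : a ≤ b)
    (h : ∀ t, a ≤ t → t < b → O' t = (O t && decide (weight O a t < θ))) :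
    weight O' a b ≤ θ + 1 / ((a : ℝ) + 1) := by
  induction b, hab using Nat.le_induction with
  | base => rw [weight_self]; positivity
  | succ b hab ih =>
    have hb := h b hab b.lt_succ_self
    have h' := fun t h1 h2 => h t h1 (Nat.lt_succ_of_lt h2)
    rw [weight_succ _ hab]
    by_cases hw : weight O a b < θ
    · have h1 : weight O' a b ≤ weight O a b :=
        weight_mono fun t h1 h2 h3 => by rw [h' t h1 h2] at h3; simp at h3; exact h3.1
      have h2 : (if O' b then 1 / ((b : ℝ) + 1) else 0) ≤ 1 / ((a : ℝ) + 1) := by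
        have : 1 / ((b : ℝ) + 1) ≤ 1 / ((a : ℝ) + 1) := by gcongr
        split_ifs
        · exact this
        · positivity
      linarith
    · rw [hb]
      simpa [hw] using ih h'

theorem min_le_weight_of_threshold {θ : ℝ} (hab : a ≤ b)
    (h : ∀ t, a ≤ t → t < b → O' t = (O t && decide (weight O a t < θ))) :
    min (weight O a b) θ ≤ weight O' a b := by
  induction b, hab using Nat.le_induction with
  | base => simp [weight_self]
  | succ b hab ih =>
    have hb := h b hab b.lt_succ_self
    have ih := ih fun t h1 h2 => h t h1 (Nat.lt_succ_of_lt h2)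
    rw [weight_succ O' hab, hb]
    by_cases hw : weight O a b < θ
    · rw [min_eq_left hw.le] at ih
      refine (min_le_left _ _).trans ?_
      rw [weight_succ O hab]
      simp only [hw, decide_true, Bool.and_true]
      linarith
    · rw [min_eq_right (not_lt.1 hw)] at ih
      simpa [hw] using Or.inr ih

/-- The total weight of `O` is infinite. -/
def Heavy (O : ℕ → Bool) : Prop := ∀ C : ℝ, ∃ b, C ≤ weight O 0 b

theorem Heavy.exists_le_weight (h : Heavy O) (a : ℕ) (C : ℝ) : ∃ b, a ≤ b ∧ C ≤ weight O a b := by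
  obtain ⟨b, hb⟩ := h (C + weight O 0 a)
  refine ⟨max a b, le_max_left _ _, ?_⟩
  have h1 := weight_add O (Nat.zero_le a) (le_max_left a b)
  have h2 := weight_mono_right O 0 (le_max_right a b)
  linarith

theorem Heavy.of_eventually_eq (h : Heavy O) (h' : ∀ t, a ≤ t → O' t = O t) : Heavy O' := by
  intro C
  obtain ⟨b, _, hb⟩ := h.exists_le_weight a C
  refine ⟨b, hb.trans ?_⟩
  refine (weight_mono fun t h1 _ h3 => ?_).trans (weight_anti_left O' b (Nat.zero_le a))
  rw [h' t h1, h3]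

end Weight

section Gate

open Nat.Partrec (Code)

theorem HaltsBy.mono {i x t t' : ℕ} (h : HaltsBy i x t) (ht : t ≤ t') : HaltsBy i x t' := by
  obtain ⟨y, hy, h⟩ := h
  exact ⟨y, Code.evaln_mono ht hy, h.trans ht⟩

theorem HaltsBy.lt {i x t : ℕ} (h : HaltsBy i x t) : x < t := by
  obtain ⟨y, hy, -⟩ := h
  exact Code.evaln_bound hy

theorem HaltsBy.le_of_mem_eval {i x t y : ℕ} (h : HaltsBy i x t)
    (hy : y ∈ (Denumerable.ofNat Code i).eval x) : y ≤ t := by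
  obtain ⟨z, hz, h⟩ := h
  exact (Part.mem_unique (Code.evaln_sound hz) hy) ▸ h

theorem exists_haltsBy {i x y : ℕ} (hy : y ∈ (Denumerable.ofNat Code i).eval x) :
    ∃ t, HaltsBy i x t := by
  obtain ⟨k, hk⟩ := Code.evaln_complete.1 hy
  exact ⟨max k y, y, Code.evaln_mono (le_max_left _ _) hk, le_max_right _ _⟩

variable (i : ℕ) (O : ℕ → Bool)

theorem gate_succ (t : ℕ) : gate i O (t + 1) = gate i O t ∨
    (¬ GateOpen i O t ∧ HaltsBy i (gate i O t).2 t ∧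
      gate i O (t + 1) = ((gate i O t).1 + 1, t + 1)) := by
  rw [gate]
  split_ifs with h
  · exact .inr ⟨h.1, h.2, rfl⟩
  · exact .inl rfl

theorem gate_fst_mono : Monotone fun t => (gate i O t).1 :=
  monotone_nat_of_le_succ fun t => by
    rcases gate_succ i O t with h | ⟨-, -, h⟩ <;> simp [h]

theorem gate_eq_of_fst_eq {s t : ℕ} (hst : s ≤ t) (h : (gate i O t).1 = (gate i O s).1) :
    gate i O t = gate i O s := by
  induction t, hst using Nat.le_induction with
  | base => rfl
  | succ t hst ih =>
    have h1 := gate_fst_mono i O hst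
    dsimp only at h1
    rcases gate_succ i O t with h2 | ⟨-, -, h2⟩
    · rw [h2] at h ⊢
      exact ih h
    · rw [h2] at h
      dsimp only at h
      omega

theorem gate_fst_le_snd_le (t : ℕ) : (gate i O t).1 ≤ (gate i O t).2 ∧ (gate i O t).2 ≤ t := by
  induction t with
  | zero => simp [gate]
  | succ t ih =>
    rcases gate_succ i O t with h | ⟨-, -, h⟩
    · rw [h]; omega
    · rw [h]; dsimp only; omega

variable {i O}

/-- The stages at which the rounds of a gate begin, when there are infinitely many. -/
theorem exists_roundStart (h : ∀ n, ∃ t, n ≤ (gate i O t).1) :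
    ∃ τ : ℕ → ℕ, τ 0 = 0 ∧ StrictMono τ ∧
      (∀ k t, τ k ≤ t → t < τ (k + 1) → gate i O t = (k, τ k)) ∧
      ∀ k, ∃ t, t + 1 = τ (k + 1) ∧ ¬ GateOpen i O t ∧ HaltsBy i (τ k) t := by
  let τ : ℕ → ℕ := fun k => Nat.find (h k)
  have hge : ∀ k, k ≤ (gate i O (τ k)).1 := fun k => Nat.find_spec (h k)
  have hlt : ∀ {k t}, t < τ k → (gate i O t).1 < k := fun {k _} ht => not_le.1 (Nat.find_min (h k) ht)
  have h0 : τ 0 = 0 := by simp [τ]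
  have hτ : ∀ k, gate i O (τ k) = (k, τ k) := by
    intro k
    rcases Nat.eq_zero_or_pos (τ k) with h1 | h1
    · have := hge k
      rw [h1] at this ⊢
      simp only [gate] at this ⊢
      simp at this
      rw [this]
    · obtain ⟨s, hs⟩ := Nat.exists_eq_succ_of_ne_zero h1.ne'
      have h2 := hlt (show s < τ k by omega)
      have h3 := hge k
      rw [hs] at h3 ⊢
      rcases gate_succ i O s with h4 | ⟨-, -, h4⟩
      · rw [Nat.succ_eq_add_one, h4] at h3; omega
      · rw [Nat.succ_eq_add_one, h4] at h3 ⊢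
        simp only at h3 ⊢
        rw [Prod.mk.injEq]
        exact ⟨by omega, rfl⟩
  have hmono : StrictMono τ := by
    refine strictMono_nat_of_lt_succ fun k => ?_
    by_contra hk
    have h1 := gate_fst_mono i O (not_lt.1 hk)
    dsimp only at h1
    rw [hτ, hτ] at h1
    dsimp only at h1
    omega
  have hin : ∀ k t, τ k ≤ t → t < τ (k + 1) → gate i O t = (k, τ k) := by
    intro k t h1 h2
    have h3 := hlt h2
    have h4 := gate_fst_mono i O h1
    dsimp only at h4
    rw [← hτ k]
    refine gate_eq_of_fst_eq i O h1 ?_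
    rw [hτ] at h4 ⊢
    dsimp only at h4 ⊢
    omega
  refine ⟨τ, h0, hmono, hin, fun k => ?_⟩
  have h1 : τ k < τ (k + 1) := hmono k.lt_succ_self
  refine ⟨τ (k + 1) - 1, by omega, ?_⟩
  have h2 := hin k (τ (k + 1) - 1) (by omega) (by omega)
  have h3 := hτ (k + 1)
  rw [show τ (k + 1) = τ (k + 1) - 1 + 1 by omega] at h3
  rcases gate_succ i O (τ (k + 1) - 1) with h4 | ⟨h4, h5, -⟩
  · rw [h4, h2] at h3
    simp at h3
  · rw [h2] at h5
    exact ⟨h4, h5⟩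

/-- The part of `O` on which the gate is open. -/
noncomputable def passed (i : ℕ) (O : ℕ → Bool) (t : ℕ) : Bool := O t && decide (GateOpen i O t)

theorem weight_passed_round {k a b : ℕ} (hab : a < b)
    (h : ∀ t, a ≤ t → t < b → gate i O t = (k, a)) :
    weight (passed i O) a b ≤ 2 / ((k : ℝ) + 1) ∧
      (∀ t, t + 1 = b → ¬ GateOpen i O t → 1 / ((k : ℝ) + 1) ≤ weight (passed i O) a b) := by
  have hpos : (0 : ℝ) < (k : ℝ) + 1 := by positivity
  have hP : ∀ t, a ≤ t → t < b → passed i O t =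
      (O t && decide (weight O a t < 1 / ((k : ℝ) + 1))) := by
    intro t h1 h2
    rw [passed, GateOpen, h t h1 h2]
  have hka : k ≤ a := by
    have := (gate_fst_le_snd_le i O a).1
    rwa [h a le_rfl hab] at this
  constructor
  · refine (weight_le_add_of_threshold (by positivity) hab.le hP).trans ?_
    have : 1 / ((a : ℝ) + 1) ≤ 1 / ((k : ℝ) + 1) := by gcongr
    rw [show (2 : ℝ) / (k + 1) = 1 / (k + 1) + 1 / (k + 1) by ring]
    linarith
  · rintro t rfl ho
    have hat : a ≤ t := Nat.lt_succ_iff.1 hab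
    rw [GateOpen, h t hat t.lt_succ_self, not_lt] at ho
    dsimp only at ho
    refine le_trans ?_ (min_le_weight_of_threshold hab.le hP)
    exact le_min (ho.trans (weight_mono_right O a t.le_succ)) le_rfl

theorem heavy_passed (h : ∀ n, ∃ t, n ≤ (gate i O t).1) : Heavy (passed i O) := by
  obtain ⟨τ, -, hmono, hin, hend⟩ := exists_roundStart h
  have hsum : ∀ n, ∑ k ∈ Finset.range n, 1 / ((k : ℝ) + 1) ≤ weight (passed i O) 0 (τ n) := by
    intro n
    induction n with
    | zero => simpa using weight_nonneg _ _ _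
    | succ n ih =>
      obtain ⟨t, ht, ho, -⟩ := hend n
      rw [Finset.sum_range_succ, ← weight_add _ (Nat.zero_le (τ n)) (hmono n.lt_succ_self).le]
      exact add_le_add ih ((weight_passed_round (hmono n.lt_succ_self) (hin n)).2 t ht ho)
  intro C
  obtain ⟨n, hn⟩ := (Real.tendsto_sum_range_one_div_nat_succ_atTop.eventually_ge_atTop C).exists
  exact ⟨τ n, hn.trans (hsum n)⟩

/-- A gate with finitely many rounds is eventually constant, and closed if its input is heavy. -/
theorem exists_gate_eq_of_bounded (h : ¬ ∀ n, ∃ t, n ≤ (gate i O t).1) :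
    ∃ T q, ∀ t, T ≤ t → gate i O t = q := by
  push Not at h
  obtain ⟨n, hn⟩ := h
  obtain ⟨T, hT⟩ : ∃ T, ∀ t, (gate i O t).1 ≤ (gate i O T).1 := by
    have hfin : (Set.range fun t => (gate i O t).1).Finite :=
      (Set.finite_lt_nat n).subset (by rintro _ ⟨t, rfl⟩; exact hn t)
    obtain ⟨_, ⟨T, rfl⟩, hT⟩ := hfin.exists_maximal (Set.range_nonempty _)
    refine ⟨T, fun t => ?_⟩
    by_contra hlt
    exact hlt (hT ⟨t, rfl⟩ (not_le.1 hlt).le)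
  exact ⟨T, _, fun t ht => gate_eq_of_fst_eq i O ht (le_antisymm (hT t) (gate_fst_mono i O ht))⟩

theorem exists_not_gateOpen_of_bounded (hO : Heavy O) (h : ¬ ∀ n, ∃ t, n ≤ (gate i O t).1) :
    ∃ T, ∀ t, T ≤ t → ¬ GateOpen i O t := by
  obtain ⟨T, q, hq⟩ := exists_gate_eq_of_bounded h
  obtain ⟨b, hb1, hb⟩ := hO.exists_le_weight q.2 (1 / ((q.1 : ℝ) + 1))
  refine ⟨max T b, fun t ht => ?_⟩
  rw [GateOpen, hq t (le_of_max_le_left ht), not_lt]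
  exact hb.trans (weight_mono_right O q.2 (le_of_max_le_right ht))

theorem rounds_unbounded_of_total (hO : Heavy O)
    (ht : ∀ x, ∃ t, HaltsBy i x t) : ∀ n, ∃ t, n ≤ (gate i O t).1 := by
  by_contra h
  obtain ⟨T, q, hq⟩ := exists_gate_eq_of_bounded h
  obtain ⟨T', hT'⟩ := exists_not_gateOpen_of_bounded hO h
  obtain ⟨t, ht⟩ := ht q.2
  let s := max t (max T T')
  have hs : T ≤ s := (le_max_left T T').trans (le_max_right _ _)
  have hs' : T' ≤ s := (le_max_right T T').trans (le_max_right _ _)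
  have h1 := hq s hs
  have h2 := hq (s + 1) (hs.trans s.le_succ)
  rw [gate, if_pos ⟨hT' s hs', by rw [h1]; exact ht.mono (le_max_left _ _)⟩, h1] at h2
  have := congrArg Prod.fst h2
  simp at this

end Gate

section TruePath

/-- The correct guesses about the gates. -/
noncomputable def truePath : ℕ → List Bool
  | 0 => []
  | e + 1 => decide (∀ n, ∃ t, n ≤ rounds (truePath e) t) :: truePath e

theorem length_truePath (e : ℕ) : (truePath e).length = e := by
  induction e with
  | zero => rfl
  | succ e ih => simp [truePath, ih]

theorem avail_true_cons (l : List Bool) : avail (true :: l) = passed l.length (avail l) := rfl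

theorem heavy_avail_truePath (e : ℕ) : Heavy (avail (truePath e)) := by
  induction e with
  | zero =>
    intro C
    obtain ⟨n, hn⟩ := (Real.tendsto_sum_range_one_div_nat_succ_atTop.eventually_ge_atTop C).exists
    refine ⟨n, hn.trans_eq ?_⟩
    simp [weight, truePath, avail]
  | succ e ih =>
    rw [truePath]
    by_cases h : ∀ n, ∃ t, n ≤ rounds (truePath e) t
    · rw [decide_eq_true h, avail_true_cons]
      exact heavy_passed h
    · rw [decide_eq_false h]
      exact ih

theorem eventually_injury_truePath (e : ℕ) :
    ∃ T n, ∀ t, T ≤ t → injury (truePath e) t = n := by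
  induction e with
  | zero => exact ⟨0, 0, fun _ _ => rfl⟩
  | succ e ih =>
    obtain ⟨T, n, hn⟩ := ih
    rw [truePath]
    by_cases h : ∀ n, ∃ t, n ≤ rounds (truePath e) t
    · rw [decide_eq_true h]
      exact ⟨T, n, hn⟩
    · rw [decide_eq_false h]
      obtain ⟨T', q, hq⟩ := exists_gate_eq_of_bounded h
      refine ⟨max T T', n + q.1, fun t ht => ?_⟩
      rw [injury, hn t (le_of_max_le_left ht), rounds, hq t (le_of_max_le_right ht)]

theorem avail_of_suffix {l l' : List Bool} (h : l' <:+ l) {t : ℕ} (ht : avail l t = true) :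
    avail l' t = true := by
  induction l with
  | nil => rw [List.suffix_nil.1 h]; exact ht
  | cons b l ih =>
    rcases List.suffix_cons_iff.1 h with rfl | h
    · exact ht
    · refine ih h ?_
      cases b
      · exact ht
      · simp only [avail, Bool.and_eq_true] at ht
        exact ht.1

theorem injury_le_of_suffix {l l' : List Bool} (h : l' <:+ l) (t : ℕ) :
    injury l' t ≤ injury l t := by
  induction l with
  | nil => rw [List.suffix_nil.1 h]
  | cons b l ih =>
    rcases List.suffix_cons_iff.1 h with rfl | h
    · exact le_rfl
    · refine (ih h).trans ?_
      cases b <;> simp [injury]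

end TruePath

section Requirements

open Nat.Partrec (Code)

theorem wants_iff {c t : ℕ} : wants c t = true ↔
    Nat.pair (Encodable.encode (strat c)) (injury (strat c) t) = c ∧ avail (strat c) t = true ∧
      HaltsBy (strat c).length c t := by
  simp [wants, and_assoc]

theorem wants_of_acts {c t : ℕ} (h : acts c t = true) : wants c t = true := by
  simp only [acts, Bool.and_eq_true] at h
  exact h.1

theorem strat_pair (l : List Bool) (n : ℕ) : strat (Nat.pair (Encodable.encode l) n) = l := by
  simp [strat]

theorem weight_acts_le (c a b : ℕ) : weight (acts c) a b ≤ 2 := by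
  refine (weight_anti_left _ b (Nat.zero_le a)).trans ?_
  refine (weight_le_add_of_threshold (O := wants c) zero_le_one (Nat.zero_le b)
    fun _ _ _ => rfl).trans ?_
  norm_num

theorem min_le_weight_acts (c b : ℕ) : min (weight (wants c) 0 b) 1 ≤ weight (acts c) 0 b :=
  min_le_weight_of_threshold (Nat.zero_le b) fun _ _ _ => rfl

theorem Heavy.eventually_not_acts {c : ℕ} (h : Heavy (wants c)) :
    ∃ T, ∀ t, T ≤ t → ¬ acts c t = true := by
  obtain ⟨b, hb⟩ := h 1
  refine ⟨b, fun t ht h1 => ?_⟩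
  simp only [acts, Bool.and_eq_true, decide_eq_true_eq] at h1
  exact absurd h1.2 (not_lt.2 (hb.trans (weight_mono_right _ 0 ht)))

/-- A requirement with a correct strategy whose program halts wants to act with infinite weight. -/
theorem heavy_wants {e T n : ℕ} (hT : ∀ t, T ≤ t → injury (truePath e) t = n)
    {s : ℕ} (hs : HaltsBy e (Nat.pair (Encodable.encode (truePath e)) n) s) :
    Heavy (wants (Nat.pair (Encodable.encode (truePath e)) n)) := by
  refine (heavy_avail_truePath e).of_eventually_eq (a := max T s) fun t ht => ?_
  rw [Bool.eq_iff_iff, wants_iff, strat_pair, length_truePath, hT t (le_of_max_le_left ht)]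
  simp [hs.mono (le_of_max_le_right ht)]

theorem eventually_not_acts_truePath (e : ℕ) :
    ∃ T, ∀ t, T ≤ t → ∀ c, strat c = truePath e → ¬ acts c t = true := by
  obtain ⟨T, n, hn⟩ := eventually_injury_truePath e
  obtain ⟨T', hT'⟩ : ∃ T', ∀ t, T' ≤ t →
      ¬ acts (Nat.pair (Encodable.encode (truePath e)) n) t = true := by
    by_cases h : ∃ s, HaltsBy e (Nat.pair (Encodable.encode (truePath e)) n) s
    · obtain ⟨s, hs⟩ := h
      exact (heavy_wants hn hs).eventually_not_acts
    · refine ⟨0, fun t _ ht => h ⟨t, ?_⟩⟩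
      have := (wants_iff.1 (wants_of_acts ht)).2.2
      rwa [strat_pair, length_truePath] at this
  refine ⟨max T T', fun t ht c hc hact => ?_⟩
  have h1 := (wants_iff.1 (wants_of_acts hact)).1
  rw [hc, hn t (le_of_max_le_left ht)] at h1
  rw [← h1] at hact
  exact hT' t (le_of_max_le_right ht) hact

theorem List.eq_or_exists_cons_suffix {α : Type*} {l l' : List α} (h : l <:+ l') :
    l' = l ∨ ∃ b, b :: l <:+ l' := by
  obtain ⟨p, rfl⟩ := h
  rcases List.eq_nil_or_concat p with rfl | ⟨p', b, rfl⟩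
  · exact .inl rfl
  · exact .inr ⟨b, p', by simp⟩

/-- The requirements that do not extend the true path up to `m` eventually only act if they are
large. -/
theorem eventually_acts_imp (m : ℕ) :
    ∃ (T : ℕ) (V : ℕ → ℕ), Primrec V ∧ Monotone V ∧ (∀ n, ∃ t, n ≤ V t) ∧
      ∀ t, T ≤ t → ∀ c, acts c t = true → truePath m <:+ strat c ∨ V t ≤ c := by
  induction m with
  | zero => exact ⟨0, id, .id, monotone_id, fun n => ⟨n, le_rfl⟩,
      fun t _ c _ => .inl (List.nil_suffix)⟩
  | succ m ih =>
    obtain ⟨T, V, hV, hmono, hunb, hact⟩ := ih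
    obtain ⟨T', hT'⟩ := eventually_not_acts_truePath m
    have hstep : ∀ t, max T T' ≤ t → ∀ c, acts c t = true →
        (∃ b, b :: truePath m <:+ strat c) ∨ V t ≤ c := by
      intro t ht c hc
      refine (hact t (le_of_max_le_left ht) c hc).imp_left fun h => ?_
      rcases List.eq_or_exists_cons_suffix h with h | h
      · exact absurd hc (hT' t (le_of_max_le_right ht) c h)
      · exact h
    by_cases h : ∀ n, ∃ t, n ≤ rounds (truePath m) t
    · rw [truePath, decide_eq_true h]
      have hr : Primrec fun t => rounds (truePath m) t := primrec_rounds.comp (.const _) .id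
      have hrm : Monotone fun t => rounds (truePath m) t := gate_fst_mono _ _
      refine ⟨max T T', fun t => min (V t) (rounds (truePath m) t), Primrec.nat_min.comp hV hr,
        hmono.min hrm, fun n => ?_, fun t ht c hc => ?_⟩
      · obtain ⟨t, ht⟩ := h n
        obtain ⟨t', ht'⟩ := hunb n
        exact ⟨max t t', le_min (ht'.trans (hmono (le_max_right _ _)))
          (ht.trans (hrm (le_max_left _ _)))⟩
      · rcases hstep t ht c hc with ⟨b, hb⟩ | h1
        · cases b
          · have h1 := injury_le_of_suffix hb t
            have h2 := (wants_iff.1 (wants_of_acts hc)).1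
            have h3 := Nat.right_le_pair (Encodable.encode (strat c)) (injury (strat c) t)
            rw [h2] at h3
            rw [injury] at h1
            exact .inr ((min_le_right _ _).trans (by omega))
          · exact .inl hb
        · exact .inr ((min_le_left _ _).trans h1)
    · rw [truePath, decide_eq_false h]
      obtain ⟨T'', hT''⟩ := exists_not_gateOpen_of_bounded (heavy_avail_truePath m) h
      refine ⟨max (max T T') T'', V, hV, hmono, hunb, fun t ht c hc => ?_⟩
      refine (hstep t (le_of_max_le_left ht) c hc).imp_left ?_
      rintro ⟨b, hb⟩
      cases b
      · exact hb
      · have h1 := avail_of_suffix hb (wants_iff.1 (wants_of_acts hc)).2.1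
        rw [avail, Bool.and_eq_true, decide_eq_true_eq] at h1
        exact absurd h1.2 (hT'' t (le_of_max_le_right ht))

end Requirements

section Approximation

open Nat.Partrec (Code)

theorem sum_Ico_geometric_le (N b : ℕ) :
    ∑ c ∈ Finset.Ico N b, (1 / 2 : ℝ) ^ (c + 3) ≤ (1 / 2) ^ (N + 2) := by
  rcases le_total b N with h | h
  · rw [Finset.Ico_eq_empty_of_le h, Finset.sum_empty]
    positivity
  · have : ∑ c ∈ Finset.Ico N b, (1 / 2 : ℝ) ^ (c + 3) = (1 / 2) ^ (N + 2) - (1 / 2) ^ (b + 2) := by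
      induction b, h using Nat.le_induction with
      | base => simp
      | succ b h ih =>
        rw [Finset.sum_Ico_succ_top h, ih]
        ring
    rw [this]
    have : (0 : ℝ) < (1 / 2) ^ (b + 2) := by positivity
    linarith

theorem approx_eq_add {a b : ℕ} (h : a ≤ b) : approx b = approx a + ∑ t ∈ Finset.Ico a b,
    ∑ c ∈ Finset.range t, (if acts c t then 1 / ((t : ℝ) + 1) else 0) * (1 / 2) ^ (c + 3) :=
  (Finset.sum_range_add_sum_Ico _ h).symm

theorem approx_term_nonneg (c t : ℕ) :
    0 ≤ (if acts c t then 1 / ((t : ℝ) + 1) else 0) * (1 / 2) ^ (c + 3) := by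
  refine mul_nonneg ?_ (by positivity)
  split_ifs <;> positivity

theorem approx_mono : Monotone approx := by
  intro a b h
  rw [approx_eq_add h]
  exact le_add_of_nonneg_right
    (Finset.sum_nonneg fun t _ => Finset.sum_nonneg fun c _ => approx_term_nonneg c t)

/-- The increase of the approximation over a period in which all acting requirements below `N`
act on `O`. -/
theorem approx_le_add {a b N : ℕ} {O : ℕ → Bool} (hab : a ≤ b)
    (h : ∀ t, a ≤ t → t < b → ∀ c, acts c t = true → O t = true ∨ N ≤ c) :
    approx b ≤ approx a + (weight O a b / 4 + (1 / 2) ^ (N + 1)) := by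
  rw [approx_eq_add hab]
  refine add_le_add le_rfl ?_
  set x : ℕ → ℕ → ℝ := fun c t =>
    (if acts c t then 1 / ((t : ℝ) + 1) else 0) * (1 / 2) ^ (c + 3) with hx
  have hx0 : ∀ c t, 0 ≤ x c t := approx_term_nonneg
  have hterm : ∀ t ∈ Finset.Ico a b, ∑ c ∈ Finset.range t, x c t ≤
      (if O t then 1 / ((t : ℝ) + 1) else 0) / 4 + ∑ c ∈ Finset.Ico N b, x c t := by
    intro t ht
    have ht := Finset.mem_Ico.1 ht
    by_cases hO : O t = true
    · refine le_add_of_le_of_nonneg ?_ (Finset.sum_nonneg fun c _ => hx0 c t)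
      rw [if_pos hO]
      have hw : (0 : ℝ) ≤ 1 / ((t : ℝ) + 1) := by positivity
      calc ∑ c ∈ Finset.range t, x c t
          ≤ ∑ c ∈ Finset.range t, 1 / ((t : ℝ) + 1) * (1 / 2) ^ (c + 3) := by
            refine Finset.sum_le_sum fun c _ => mul_le_mul_of_nonneg_right ?_ (by positivity)
            split_ifs
            · exact le_rfl
            · exact hw
        _ = 1 / ((t : ℝ) + 1) * ∑ c ∈ Finset.Ico 0 t, (1 / 2) ^ (c + 3) := by
            rw [Finset.mul_sum, Finset.range_eq_Ico]
        _ ≤ 1 / ((t : ℝ) + 1) * (1 / 2) ^ (0 + 2) :=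
            mul_le_mul_of_nonneg_left (sum_Ico_geometric_le 0 t) hw
        _ = 1 / ((t : ℝ) + 1) / 4 := by ring
    · rw [if_neg hO, zero_div, zero_add]
      have h1 : ∑ c ∈ Finset.range t, x c t = ∑ c ∈ Finset.Ico N t, x c t := by
        refine (Finset.sum_subset (fun c hc => ?_) fun c hc hc' => ?_).symm
        · exact Finset.mem_range.2 (Finset.mem_Ico.1 hc).2
        · have hc1 := Finset.mem_range.1 hc
          have hna : ¬ acts c t = true := fun hact => by
            rcases h t ht.1 ht.2 c hact with h2 | h2
            · exact hO h2
            · exact hc' (Finset.mem_Ico.2 ⟨h2, hc1⟩)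
          simp [hx, hna]
      rw [h1]
      exact Finset.sum_le_sum_of_subset_of_nonneg (Finset.Ico_subset_Ico_right ht.2.le)
        fun c _ _ => hx0 c t
  refine (Finset.sum_le_sum hterm).trans ?_
  rw [Finset.sum_add_distrib, ← Finset.sum_div, Finset.sum_comm]
  refine add_le_add le_rfl ?_
  calc ∑ c ∈ Finset.Ico N b, ∑ t ∈ Finset.Ico a b, x c t
      = ∑ c ∈ Finset.Ico N b, weight (acts c) a b * (1 / 2) ^ (c + 3) := by
        refine Finset.sum_congr rfl fun c _ => ?_
        rw [weight, Finset.sum_mul]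
    _ ≤ ∑ c ∈ Finset.Ico N b, 2 * (1 / 2) ^ (c + 3) := Finset.sum_le_sum fun c _ =>
        mul_le_mul_of_nonneg_right (weight_acts_le c a b) (by positivity)
    _ = 2 * ∑ c ∈ Finset.Ico N b, (1 / 2) ^ (c + 3) := (Finset.mul_sum _ _ _).symm
    _ ≤ 2 * (1 / 2) ^ (N + 2) :=
        mul_le_mul_of_nonneg_left (sum_Ico_geometric_le N b) zero_le_two
    _ = (1 / 2) ^ (N + 1) := by ring

theorem approx_le_half (b : ℕ) : approx b ≤ 1 / 2 := by
  have h := approx_le_add (N := 0) (O := fun _ => false) (Nat.zero_le b)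
    fun t _ _ c _ => .inr (Nat.zero_le c)
  have h0 : approx 0 = 0 := by simp [approx]
  rw [h0] at h
  simpa [weight] using h

theorem Computable.exists_haltsBy_index {f : ℕ → ℕ} (hf : Computable f) :
    ∃ i, ∀ x, (∃ t, HaltsBy i x t) ∧ ∀ t, HaltsBy i x t → f x ≤ t := by
  obtain ⟨c, hc⟩ := Code.exists_code.1 (Partrec.nat_iff.1 hf)
  have hmem : ∀ x, f x ∈ (Denumerable.ofNat Code (Encodable.encode c)).eval x := fun x => by
    rw [Denumerable.ofNat_encode, hc]
    exact Part.mem_some _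
  exact ⟨Encodable.encode c, fun x => ⟨exists_haltsBy (hmem x), fun t ht => ht.le_of_mem_eval (hmem x)⟩⟩

/-- No computable function bounds the speed of convergence of the approximations. -/
theorem exists_approx_add_le {f : ℕ → ℕ} (hf : Computable f) :
    ∃ c b, approx (f c) + (1 / 2) ^ (c + 3) ≤ approx b := by
  obtain ⟨e, he⟩ := hf.exists_haltsBy_index
  obtain ⟨T, n, hn⟩ := eventually_injury_truePath e
  set c := Nat.pair (Encodable.encode (truePath e)) n with hc
  obtain ⟨⟨s, hs⟩, hle⟩ := he c
  obtain ⟨b, hfb, hb⟩ := (heavy_wants hn hs).exists_le_weight (f c) 1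
  have hb' : 1 ≤ weight (wants c) 0 b := hb.trans (weight_anti_left _ b (Nat.zero_le _))
  have h1 : 1 ≤ weight (acts c) 0 b := by
    have := min_le_weight_acts c b
    rwa [min_eq_right hb'] at this
  have hhalt : ∀ t, acts c t = true → HaltsBy e c t := fun t ht => by
    have := (wants_iff.1 (wants_of_acts ht)).2.2
    rwa [hc, strat_pair, length_truePath, ← hc] at this
  have h2 : weight (acts c) 0 (f c) = 0 := Finset.sum_eq_zero fun t ht => by
    rw [if_neg fun hact => absurd (hle t (hhalt t hact)) (not_le.2 (Finset.mem_Ico.1 ht).2)]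
  rw [← weight_add _ (Nat.zero_le _) hfb, h2, zero_add] at h1
  refine ⟨c, b, ?_⟩
  rw [approx_eq_add hfb]
  refine add_le_add le_rfl ?_
  calc (1 / 2 : ℝ) ^ (c + 3) ≤ weight (acts c) (f c) b * (1 / 2) ^ (c + 3) :=
        le_mul_of_one_le_left (by positivity) h1
    _ = ∑ t ∈ Finset.Ico (f c) b,
        (if acts c t then 1 / ((t : ℝ) + 1) else 0) * (1 / 2) ^ (c + 3) := Finset.sum_mul _ _ _
    _ ≤ _ := Finset.sum_le_sum fun t _ => ?_
  by_cases hact : acts c t = true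
  · exact Finset.single_le_sum (f := fun c =>
      (if acts c t then 1 / ((t : ℝ) + 1) else 0) * (1 / 2 : ℝ) ^ (c + 3))
      (fun c _ => approx_term_nonneg c t) (Finset.mem_range.2 (hhalt t hact).lt)
  · rw [if_neg hact, zero_mul]
    exact Finset.sum_nonneg fun c _ => approx_term_nonneg c t

/-- The constructed real. -/
noncomputable def limitReal : ℝ := ⨆ s, approx s

theorem bddAbove_approx : BddAbove (Set.range approx) :=
  ⟨1 / 2, by rintro _ ⟨b, rfl⟩; exact approx_le_half b⟩

theorem approx_le_limitReal (s : ℕ) : approx s ≤ limitReal := le_ciSup bddAbove_approx s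

theorem tendsto_approx : Filter.Tendsto approx Filter.atTop (nhds limitReal) :=
  tendsto_atTop_ciSup approx_mono bddAbove_approx

theorem limitReal_mem_Ioo : limitReal ∈ Set.Ioo (0 : ℝ) 1 := by
  constructor
  · obtain ⟨c, b, h⟩ := exists_approx_add_le (Computable.const 0)
    have h0 : approx 0 = 0 := by simp [approx]
    rw [h0] at h
    have hp : (0 : ℝ) < (1 / 2) ^ (c + 3) := by positivity
    have := approx_le_limitReal b
    linarith
  · exact (ciSup_le approx_le_half).trans_lt (by norm_num)

theorem leftCE_limitReal : LeftCE limitReal := by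
  obtain ⟨q, hq, h⟩ := primrecReal_approx.exists_computable_rat
  refine ⟨q, hq, fun a b hab => ?_, ?_⟩
  · have := approx_mono hab
    rw [← h, ← h] at this
    exact_mod_cast this
  · simpa only [h] using tendsto_approx

theorem not_leftCE_neg_limitReal : ¬ LeftCE (-limitReal) := by
  rintro ⟨r, hr, hmono, htend⟩
  have hle : ∀ m, limitReal ≤ -(r m : ℝ) := fun m => by
    have hmono' : Monotone fun n => (r n : ℝ) := fun a b hab => Rat.cast_le.2 (hmono hab)
    have := hmono'.ge_of_tendsto htend m
    linarith
  have habs : ∀ m, -(r m : ℝ) = ((r m).num.natAbs : ℝ) / (((r m).den - 1 : ℕ) + 1 : ℕ) := fun m => by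
    have h1 : (r m : ℝ) < 0 := by
      have := hle m
      have := limitReal_mem_Ioo.1
      linarith
    have h2 : (r m).num < 0 := Rat.num_neg.2 (by exact_mod_cast h1)
    rw [Nat.sub_add_cancel (r m).den_pos, Rat.cast_def, ← neg_div]
    congr 1
    rw [Nat.cast_natAbs, abs_of_neg h2]
    push_cast
    rfl
  have hpred : ComputablePred fun p : ℕ × ℕ =>
      -(r p.2 : ℝ) < approx p.2 + (1 / 2) ^ (p.1 + 3) := by
    have h1 : PrimrecPred fun q : (ℕ × ℕ) × ℕ × ℕ =>
        (q.1.1 : ℝ) / (q.1.2 + 1 : ℕ) < approx q.2.2 + (1 / 2) ^ (q.2.1 + 3) := by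
      have hs : Primrec fun q : (ℕ × ℕ) × ℕ × ℕ => q.2 := Primrec.snd
      refine PrimrecReal.lt ((PrimrecReal.natCast (Primrec.fst.comp Primrec.fst)).div_natCast
        (Primrec.succ.comp (Primrec.snd.comp Primrec.fst)) fun _ => Nat.succ_pos _) ?_
      exact (primrecReal_approx.comp (Primrec.snd.comp hs)).add (PrimrecReal.one_div_two_pow
        (Primrec.nat_add.comp (Primrec.fst.comp hs) (.const 3)))
    have h2 : Computable fun p : ℕ × ℕ => r p.2 := hr.comp Computable.snd
    obtain ⟨_, h3⟩ := h1
    refine ⟨inferInstance, (h3.to_comp.comp (((computable_rat_natAbs_num.comp h2).pair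
      (Primrec.pred.to_comp.comp (computable_rat_den.comp h2))).pair Computable.id)).of_eq
      fun p => ?_⟩
    simp only [habs]
    exact decide_eq_decide.2 Iff.rfl
  have hex : ∀ c, ∃ m, -(r m : ℝ) < approx m + (1 / 2) ^ (c + 3) := fun c => by
    have h1 : Filter.Tendsto (fun m => approx m + (1 / 2) ^ (c + 3) + r m) Filter.atTop
        (nhds (limitReal + (1 / 2) ^ (c + 3) + -limitReal)) :=
      (tendsto_approx.add_const _).add htend
    have hp : (0 : ℝ) < (1 / 2) ^ (c + 3) := by positivity
    obtain ⟨m, hm⟩ := (h1.eventually_const_lt (u := 0) (by linarith)).exists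
    exact ⟨m, by linarith⟩
  obtain ⟨f, hf, hspec⟩ := exists_computable_choice hpred hex
  obtain ⟨c, b, h⟩ := exists_approx_add_le hf
  have h1 := hspec c
  have h2 := hle (f c)
  have h3 := approx_le_limitReal b
  linarith

end Approximation

section Presentations

open Nat.Partrec (Code)

theorem REPred.exists_nat {α : Type*} [Primcodable α] {P : α → ℕ → Prop}
    (hP : PrimrecPred fun p : α × ℕ => P p.1 p.2) : REPred fun a => ∃ n, P a n := by
  obtain ⟨_, h⟩ := hP
  have h1 : Partrec₂ fun (a : α) (n : ℕ) => (Part.some (decide (P a n)) : Part Bool) :=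
    h.to_comp.of_eq fun p => by congr!
  refine (Partrec.rfind h1).dom_re.of_eq fun a => ?_
  exact (Nat.rfind_dom (p := fun n => Part.some (decide (P a n)))).trans (by simp)

/-- A machine halts on `σ` within `s` steps. -/
def EntersBy (cM : Code) (s : ℕ) (σ : List Bool) : Prop :=
  (Code.evaln s cM (Encodable.encode σ)).isSome = true

theorem EntersBy.mono {cM : Code} {s t : ℕ} {σ : List Bool} (h : EntersBy cM s σ) (hst : s ≤ t) :
    EntersBy cM t σ := by
  obtain ⟨y, hy⟩ := Option.isSome_iff_exists.1 h
  exact Option.isSome_iff_exists.2 ⟨y, Code.evaln_mono hst hy⟩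

theorem primrecPred_entersBy (cM : Code) : PrimrecPred fun p : ℕ × List Bool =>
    EntersBy cM p.1 p.2 :=
  Primrec.eq.comp (Primrec.option_isSome.comp (Code.primrec_evaln.comp
    ((Primrec.fst.pair (.const cM)).pair (Primrec.encode.comp Primrec.snd)))) (.const true)

theorem PFMachine.exists_entersBy (M : PFMachine) :
    ∃ cM : Code, ∀ σ, (M.f σ).Dom ↔ ∃ s, EntersBy cM s σ := by
  obtain ⟨cM, hcM⟩ := Code.exists_code.1 M.partrec
  refine ⟨cM, fun σ => ?_⟩
  have h1 : (M.f σ).Dom ↔ (cM.eval (Encodable.encode σ)).Dom := by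
    rw [hcM]
    simp
  rw [h1, Part.dom_iff_mem]
  constructor
  · rintro ⟨y, hy⟩
    obtain ⟨k, hk⟩ := Code.evaln_complete.1 hy
    exact ⟨k, Option.isSome_iff_exists.2 ⟨y, hk⟩⟩
  · rintro ⟨s, hs⟩
    obtain ⟨y, hy⟩ := Option.isSome_iff_exists.1 hs
    exact ⟨y, Code.evaln_sound hy⟩

/-- The set of strings on which a machine has halted within `s` steps. -/
noncomputable def entered (cM : Code) (s : ℕ) : Finset (List Bool) :=
  ((Finset.range s).preimage Encodable.encode Encodable.encode_injective.injOn).filter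
    (EntersBy cM s)

theorem mem_entered {cM : Code} {s : ℕ} {σ : List Bool} : σ ∈ entered cM s ↔ EntersBy cM s σ := by
  simp only [entered, Finset.mem_filter, Finset.mem_preimage, Finset.mem_range,
    and_iff_right_iff_imp]
  intro h
  obtain ⟨y, hy⟩ := Option.isSome_iff_exists.1 h
  exact Code.evaln_bound hy

/-- The part of the halting probability contributed within `s` steps. -/
noncomputable def omegaBy (cM : Code) (s : ℕ) : ℝ := ∑ σ ∈ entered cM s, (1 / 2) ^ σ.length

theorem omegaBy_mono (cM : Code) : Monotone (omegaBy cM) := fun s t hst =>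
  Finset.sum_le_sum_of_subset_of_nonneg
    (fun _ h => mem_entered.2 ((mem_entered.1 h).mono hst)) fun σ _ _ => by positivity

theorem primrec_list_length_getD_decode :
    Primrec fun n : ℕ => ((Encodable.decode n : Option (List Bool)).getD []).length :=
  Primrec.list_length.comp (Primrec.option_getD.comp Primrec.decode (.const []))

theorem primrecReal_omegaBy (cM : Code) : PrimrecReal (omegaBy cM) := by
  let R : ℕ × ℕ → Prop := fun p => EntersBy cM p.1
    ((Encodable.decode p.2 : Option (List Bool)).getD []) ∧
    Encodable.encode (Encodable.decode p.2 : Option (List Bool)) = p.2 + 1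
  have hdec : Primrec fun p : ℕ × ℕ => (Encodable.decode p.2 : Option (List Bool)) :=
    Primrec.decode.comp Primrec.snd
  have hR : PrimrecPred R := ((primrecPred_entersBy cM).comp (Primrec.fst.pair
      (Primrec.option_getD.comp hdec (.const [])))).and
    (Primrec.eq.comp (Primrec.encode.comp hdec) (Primrec.succ.comp Primrec.snd))
  have h0 : PrimrecReal fun _ : ℕ × ℕ => (0 : ℝ) := by
    simpa using PrimrecReal.natCast (α := ℕ × ℕ) (.const 0)
  have h1 := PrimrecReal.ite hR (PrimrecReal.one_div_two_pow
    (primrec_list_length_getD_decode.comp Primrec.snd)) h0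
  have h2 := PrimrecReal.sum_range (α := ℕ) (r := fun s n => if R (s, n) then (1 / 2 : ℝ) ^
    ((Encodable.decode n : Option (List Bool)).getD []).length else 0) h1 Primrec.id
  refine (congrArg PrimrecReal (funext fun s => ?_)).mp h2
  have hRσ : ∀ σ : List Bool, R (s, Encodable.encode σ) ↔ EntersBy cM s σ := fun σ => by
    simp [R]
  rw [omegaBy, entered, Finset.sum_filter, id]
  rw [← Finset.sum_preimage (Encodable.encode (α := List Bool)) (Finset.range s)
    Encodable.encode_injective.injOn]
  · refine Finset.sum_congr rfl fun σ _ => ?_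
    simp [hRσ]
  · intro n _ hn
    refine if_neg fun hr => hn ?_
    have h3 := hr.2
    dsimp only at h3
    cases h4 : (Encodable.decode n : Option (List Bool)) with
    | none => rw [h4] at h3; simp at h3
    | some σ =>
      rw [h4, Encodable.encode_some] at h3
      exact ⟨σ, by omega⟩

variable {M : PFMachine} {cM : Code}

theorem hasSum_omegaOf (h : 0 < omegaOf M) :
    HasSum (fun σ : {σ : List Bool // (M.f σ).Dom} => (1 / 2 : ℝ) ^ σ.1.length) (omegaOf M) := by
  have h1 : (fun σ : {σ : List Bool // (M.f σ).Dom} => (2 : ℝ) ^ (-(σ.1.length : ℤ))) =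
      fun σ => (1 / 2 : ℝ) ^ σ.1.length := by
    funext σ
    simp
  have h2 : Summable fun σ : {σ : List Bool // (M.f σ).Dom} => (1 / 2 : ℝ) ^ σ.1.length := by
    by_contra hs
    rw [omegaOf, h1, tsum_eq_zero_of_not_summable hs] at h
    exact lt_irrefl _ h
  rw [omegaOf, h1]
  exact h2.hasSum

theorem omegaBy_le (hM : ∀ σ, (M.f σ).Dom ↔ ∃ s, EntersBy cM s σ) (h : 0 < omegaOf M) (s : ℕ) :
    omegaBy cM s ≤ omegaOf M := by
  have h1 := sum_le_hasSum ((entered cM s).subtype fun σ => (M.f σ).Dom)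
    (fun σ _ => by positivity) (hasSum_omegaOf h)
  rwa [Finset.sum_subtype_of_mem (fun σ : List Bool => (1 / 2 : ℝ) ^ σ.length)
    fun σ hσ => (hM σ).2 ⟨s, mem_entered.1 hσ⟩] at h1

theorem exists_lt_omegaBy (hM : ∀ σ, (M.f σ).Dom ↔ ∃ s, EntersBy cM s σ) (h : 0 < omegaOf M)
    {x : ℝ} (hx : x < omegaOf M) : ∃ s, x < omegaBy cM s := by
  obtain ⟨S, hS⟩ := ((hasSum_omegaOf h).eventually_const_lt hx).exists
  choose! e he using fun σ => (hM σ).1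
  obtain ⟨s, hs⟩ : ∃ s, ∀ σ ∈ S, e σ.1 ≤ s :=
    ⟨S.sup fun σ => e σ.1, fun σ hσ => Finset.le_sup (f := fun σ => e σ.1) hσ⟩
  refine ⟨s, hS.trans_le ?_⟩
  refine (Finset.sum_map S (Function.Embedding.subtype _)
    fun σ : List Bool => (1 / 2 : ℝ) ^ σ.length).symm.trans_le ?_
  refine Finset.sum_le_sum_of_subset_of_nonneg (fun σ hσ => ?_) fun σ _ _ => by positivity
  obtain ⟨τ, hτ, rfl⟩ := Finset.mem_map.1 hσ
  exact mem_entered.2 ((he τ.1 τ.2).mono (hs τ hτ))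

/-- A computable function bounding how fast two equal left-c.e. reals catch up with each other. -/
theorem exists_computable_catch_up (hM : ∀ σ, (M.f σ).Dom ↔ ∃ s, EntersBy cM s σ)
    (h : omegaOf M = limitReal) : ∃ f : ℕ → ℕ, Computable f ∧ ∀ t,
      approx t < omegaBy cM (f t) + (1 / 2) ^ t ∧ omegaBy cM t < approx (f t) + (1 / 2) ^ t := by
  have hpos : 0 < omegaOf M := h ▸ limitReal_mem_Ioo.1
  refine exists_computable_choice (P := fun t s => approx t < omegaBy cM s + (1 / 2) ^ t ∧
    omegaBy cM t < approx s + (1 / 2) ^ t) (PrimrecPred.computablePred (.and ?_ ?_)) fun t => ?_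
  · exact (primrecReal_approx.comp Primrec.fst).lt
      (((primrecReal_omegaBy cM).comp Primrec.snd).add (PrimrecReal.one_div_two_pow Primrec.fst))
  · exact ((primrecReal_omegaBy cM).comp Primrec.fst).lt
      ((primrecReal_approx.comp Primrec.snd).add (PrimrecReal.one_div_two_pow Primrec.fst))
  · have hp : (0 : ℝ) < (1 / 2) ^ t := by positivity
    obtain ⟨s, hs⟩ := exists_lt_omegaBy hM hpos (x := limitReal - (1 / 2) ^ t) (by linarith)
    obtain ⟨s', hs'⟩ := (tendsto_approx.eventually_const_lt (u := limitReal - (1 / 2) ^ t)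
      (by linarith)).exists
    have h1 := omegaBy_mono cM (le_max_left s s')
    have h2 := approx_mono (le_max_right s s')
    have h3 := approx_le_limitReal t
    have h4 := omegaBy_le hM hpos t
    exact ⟨max s s', by linarith, by linarith⟩

/-- A string entering late between two rounds of a gate that waits for the machine to catch up is
long. -/
theorem pow_length_le_of_entersBy {i T N k : ℕ} {f V τ : ℕ → ℕ}
    (hf : ∀ t, approx t < omegaBy cM (f t) + (1 / 2) ^ t ∧
      omegaBy cM t < approx (f t) + (1 / 2) ^ t)
    (hi : ∀ x t, HaltsBy i x t → f x ≤ t) (hV : Monotone V)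
    (hact : ∀ t, T ≤ t → ∀ c, acts c t = true →
      (true :: truePath i) <:+ strat c ∨ V t ≤ c)
    (hmono : StrictMono τ)
    (hin : ∀ k t, τ k ≤ t → t < τ (k + 1) → gate i (avail (truePath i)) t = (k, τ k))
    (hend : ∀ k, ∃ t, t + 1 = τ (k + 1) ∧ ¬ GateOpen i (avail (truePath i)) t ∧ HaltsBy i (τ k) t)
    (hT : T ≤ τ k) (hN : N ≤ V (τ k)) {σ : List Bool}
    (h1 : ¬ EntersBy cM (τ (k + 1)) σ) (h2 : EntersBy cM (τ (k + 2)) σ) :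
    (1 / 2 : ℝ) ^ σ.length ≤ 3 / 2 / ((k : ℝ) + 1) + (1 / 2) ^ (N + 1) + 2 * (1 / 2) ^ k := by
  have hcatch : ∀ k, approx (τ k) < omegaBy cM (τ (k + 1)) + (1 / 2) ^ τ k ∧
      omegaBy cM (τ k) < approx (τ (k + 1)) + (1 / 2) ^ τ k := by
    intro k
    obtain ⟨t, ht, -, hh⟩ := hend k
    have hle : f (τ k) ≤ τ (k + 1) := by have := hi _ _ hh; omega
    exact ⟨(hf _).1.trans_le (by have := omegaBy_mono cM hle; linarith),
      (hf _).2.trans_le (by have := approx_mono hle; linarith)⟩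
  have hσ : (1 / 2 : ℝ) ^ σ.length + omegaBy cM (τ (k + 1)) ≤ omegaBy cM (τ (k + 2)) := by
    rw [omegaBy, ← Finset.sum_insert (f := fun σ : List Bool => (1 / 2 : ℝ) ^ σ.length)
      (fun h => h1 (mem_entered.1 h))]
    refine Finset.sum_le_sum_of_subset_of_nonneg (fun ρ hρ => mem_entered.2 ?_)
      fun σ _ _ => by positivity
    rcases Finset.mem_insert.1 hρ with rfl | hρ
    · exact h2
    · exact (mem_entered.1 hρ).mono (hmono (Nat.lt_succ_self _)).le
  have hpow : ∀ j, k ≤ j → (1 / 2 : ℝ) ^ τ j ≤ (1 / 2) ^ k := fun j hj =>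
    pow_le_pow_of_le_one (by norm_num) (by norm_num) (hj.trans (hmono.id_le j))
  have hround : ∀ j, k ≤ j →
      weight (avail (true :: truePath i)) (τ j) (τ (j + 1)) ≤ 2 / ((k : ℝ) + 1) := by
    intro j hj
    rw [avail_true_cons, length_truePath]
    refine (weight_passed_round (hmono j.lt_succ_self) (hin j)).1.trans ?_
    gcongr
  have hle := fun a b (h : a ≤ b) => hmono.monotone h
  have hw : weight (avail (true :: truePath i)) (τ k) (τ (k + 3)) ≤ 3 * (2 / ((k : ℝ) + 1)) := by
    rw [← weight_add _ (hle k (k + 2) (by omega)) (hle (k + 2) (k + 3) (by omega)),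
      ← weight_add _ (hle k (k + 1) (by omega)) (hle (k + 1) (k + 2) (by omega))]
    have h3 := hround k le_rfl
    have h4 := hround (k + 1) (by omega)
    have h5 := hround (k + 2) (by omega)
    simp only [add_assoc, Nat.reduceAdd] at h4 h5
    linarith
  have hinc := approx_le_add (N := N) (O := avail (true :: truePath i))
    (hle k (k + 3) (by omega)) fun t h3 _ c hc => by
      refine (hact t (hT.trans h3) c hc).imp (fun h => ?_) fun h => (hN.trans (hV h3)).trans h
      exact avail_of_suffix h (wants_iff.1 (wants_of_acts hc)).2.1
  have h3 := (hcatch k).1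
  have h4 := (hcatch (k + 2)).2
  have h5 := hpow k le_rfl
  have h6 := hpow (k + 2) (by omega)
  have h7 : (3 : ℝ) * (2 / ((k : ℝ) + 1)) / 4 = 3 / 2 / ((k : ℝ) + 1) := by ring
  linarith

theorem computablePred_dom_of_omegaOf_eq (h : omegaOf M = limitReal) :
    ComputablePred fun σ => (M.f σ).Dom := by
  obtain ⟨cM, hM⟩ := M.exists_entersBy
  obtain ⟨f, hfc, hf⟩ := exists_computable_catch_up hM h
  obtain ⟨i, hi⟩ := hfc.exists_haltsBy_index
  have hunb : ∀ n, ∃ t, n ≤ rounds (truePath i) t := by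
    unfold rounds
    rw [length_truePath]
    exact rounds_unbounded_of_total (heavy_avail_truePath i) fun x => (hi x).1
  obtain ⟨T, V, hVp, hVm, hVu, hact⟩ := eventually_acts_imp (i + 1)
  rw [truePath, decide_eq_true hunb] at hact
  have hunb' := hunb
  unfold rounds at hunb'
  rw [length_truePath] at hunb'
  obtain ⟨τ, hτ0, hmono, hin, hend⟩ := exists_roundStart hunb'
  have hrounds : ∀ t k, k ≤ rounds (truePath i) t ↔ τ k ≤ t := by
    intro t k
    have hr : Monotone (rounds (truePath i)) := gate_fst_mono _ _
    have hτ : ∀ k, rounds (truePath i) (τ k) = k := fun k => by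
      rw [rounds, length_truePath, hin k _ le_rfl (hmono k.lt_succ_self)]
    constructor
    · intro hk
      by_contra hlt
      cases k with
      | zero => omega
      | succ k =>
        rcases lt_or_ge t (τ 0) with h0 | h0
        · omega
        · have hj : ∃ j ≤ k, τ j ≤ t ∧ t < τ (j + 1) := by
            clear hk
            induction k with
            | zero => exact ⟨0, le_rfl, h0, not_le.1 hlt⟩
            | succ k ih =>
              by_cases h1 : τ (k + 1) ≤ t
              · exact ⟨k + 1, le_rfl, h1, not_le.1 hlt⟩
              · obtain ⟨j, hj, h2⟩ := ih h1
                exact ⟨j, hj.trans k.le_succ, h2⟩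
          obtain ⟨j, hj, h1, h2⟩ := hj
          rw [rounds, length_truePath, hin j t h1 h2] at hk
          dsimp only at hk
          omega
    · intro hk
      exact (hτ k).symm.trans_le (hr hk)
  let P : List Bool → ℕ → ℕ → Prop := fun σ t s => T ≤ t ∧ σ.length + 3 ≤ V t ∧
    2 ^ (σ.length + 3) ≤ rounds (truePath i) t ∧
    rounds (truePath i) t + 2 ≤ rounds (truePath i) s ∧ ¬ EntersBy cM s σ
  have hcompl : ∀ σ, ¬ (M.f σ).Dom ↔ ∃ n : ℕ, P σ n.unpair.1 n.unpair.2 := by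
    intro σ
    constructor
    · intro hσ
      obtain ⟨t₁, h₁⟩ := hVu (σ.length + 3)
      obtain ⟨t₂, h₂⟩ := hunb (2 ^ (σ.length + 3))
      have hr : Monotone (rounds (truePath i)) := gate_fst_mono _ _
      set t := max T (max t₁ t₂) with ht
      have ht₁ : t₁ ≤ t := (le_max_left _ _).trans (le_max_right _ _)
      have ht₂ : t₂ ≤ t := (le_max_right _ _).trans (le_max_right _ _)
      obtain ⟨s, hs⟩ := hunb (rounds (truePath i) t + 2)
      refine ⟨Nat.pair t s, ?_⟩
      simp only [Nat.unpair_pair]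
      exact ⟨le_max_left _ _, h₁.trans (hVm ht₁), h₂.trans (hr ht₂), hs,
        fun h => hσ ((hM σ).2 ⟨s, h⟩)⟩
    · rintro ⟨n, hn⟩ hdom
      generalize n.unpair.1 = t at hn
      generalize n.unpair.2 = s at hn
      obtain ⟨hT, hV, hk, hs, hσ⟩ := hn
      set k₀ := rounds (truePath i) t with hk₀
      have htk : t < τ (k₀ + 1) := by
        by_contra hlt
        have := (hrounds t (k₀ + 1)).2 (not_lt.1 hlt)
        omega
      have hσ' : ¬ EntersBy cM (τ (k₀ + 2)) σ := fun h => hσ (h.mono ((hrounds s _).1 hs))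
      obtain ⟨r, hr⟩ := (hM σ).1 hdom
      have hex : ∃ j, EntersBy cM (τ j) σ := ⟨r, hr.mono (hmono.id_le r)⟩
      obtain ⟨j, hj, hmin⟩ : ∃ j, EntersBy cM (τ j) σ ∧ ∀ l < j, ¬ EntersBy cM (τ l) σ :=
        ⟨Nat.find hex, Nat.find_spec hex, fun l => Nat.find_min hex⟩
      have hj₀ : k₀ + 2 < j := not_le.1 fun hle => hσ' (hj.mono (hmono.monotone hle))
      obtain ⟨k, rfl⟩ := Nat.exists_eq_add_of_le' (by omega : 2 ≤ j)
      have htk' : t ≤ τ k := htk.le.trans (hmono.monotone (by omega))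
      have hlen := pow_length_le_of_entersBy hf (fun x => (hi x).2) hVm hact hmono hin hend
        (hT.trans htk') (hV.trans (hVm htk')) (hmin (k + 1) (by omega)) hj
      have hk' : 2 ^ (σ.length + 3) ≤ k := hk.trans (by omega)
      have hlk : σ.length + 4 ≤ k := Nat.lt_two_pow_self.trans_le hk'
      have hp : (0 : ℝ) < (1 / 2) ^ σ.length := by positivity
      have h1 : (1 / 2 : ℝ) ^ k ≤ (1 / 2) ^ (σ.length + 4) :=
        pow_le_pow_of_le_one (by norm_num) (by norm_num) hlk
      have h2 : (3 : ℝ) / 2 / ((k : ℝ) + 1) ≤ 3 / 2 * (1 / 2) ^ (σ.length + 3) := by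
        have h3 : (2 : ℝ) ^ (σ.length + 3) ≤ (k : ℝ) + 1 := by
          have : ((2 ^ (σ.length + 3) : ℕ) : ℝ) ≤ k := by exact_mod_cast hk'
          push_cast at this
          linarith
        rw [one_div_pow, mul_one_div]
        gcongr
      simp only [pow_add] at h1 h2 hlen
      norm_num at h1 h2 hlen
      linarith
  refine ComputablePred.computable_iff_re_compl_re.2 ⟨M.partrec.dom_re, ?_⟩
  refine (REPred.exists_nat (P := fun σ n => P σ n.unpair.1 n.unpair.2) ?_).of_eq
    fun σ => (hcompl σ).symm
  have ht : Primrec fun p : List Bool × ℕ => p.2.unpair.1 :=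
    Primrec.fst.comp (Primrec.unpair.comp Primrec.snd)
  have hs : Primrec fun p : List Bool × ℕ => p.2.unpair.2 :=
    Primrec.snd.comp (Primrec.unpair.comp Primrec.snd)
  have hl : Primrec fun p : List Bool × ℕ => p.1.length + 3 :=
    Primrec.nat_add.comp (Primrec.list_length.comp Primrec.fst) (.const 3)
  have hrt := primrec_rounds.comp (Primrec.const (truePath i)) ht
  have hrs := primrec_rounds.comp (Primrec.const (truePath i)) hs
  exact (Primrec.nat_le.comp (.const T) ht).and ((Primrec.nat_le.comp hl (hVp.comp ht)).and
    ((Primrec.nat_le.comp (primrec_two_pow.comp hl) hrt).and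
      ((Primrec.nat_le.comp (Primrec.succ.comp (Primrec.succ.comp hrt)) hrs).and
        ((primrecPred_entersBy cM).comp (hs.pair Primrec.fst)).not)))

end Presentations

/-- There exists a non-computable left-c.e. real α in (0,1) such that
every prefix-free machine M with Ω_M = α has a computable (decidable) domain. -/
theorem stmt_1 :
    ∃ α : ℝ, α ∈ Set.Ioo (0:ℝ) 1 ∧ LeftCE α ∧ ¬ ComputableReal α ∧
      ∀ M : PFMachine, omegaOf M = α → ComputablePred fun σ => (M.f σ).Dom := by
  exact ⟨limitReal, limitReal_mem_Ioo, leftCE_limitReal, fun h => not_leftCE_neg_limitReal h.2,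
    fun _ h => computablePred_dom_of_omegaOf_eq h⟩
end

section
/- For every universal prefix-free machine U, the halting probability Ω_U is Martin-Löf random. -/
open scoped Classical

/-- A finite sum with computable bound and computable terms is computable. -/
theorem Computable.sum_range {α : Type*} [Primcodable α] {g : α → ℕ} {f : α → ℕ → ℕ}
    (hg : Computable g) (hf : Computable₂ f) :
    Computable fun a => ∑ i ∈ Finset.range (g a), f a i := by
  have step : Computable₂ fun (a : α) (p : ℕ × ℕ) => p.2 + f a p.1 :=
    (Primrec.nat_add.to_comp.comp (Computable.snd.comp Computable.snd)
      (hf.comp Computable.fst (Computable.fst.comp Computable.snd)))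
  refine (Computable.nat_rec hg (Computable.const 0) step).of_eq fun a => ?_
  generalize g a = n
  induction n with
  | zero => rfl
  | succ n ih => rw [Finset.sum_range_succ, ← ih]

theorem Computable.nat_add {α : Type*} [Primcodable α] {f g : α → ℕ} (hf : Computable f)
    (hg : Computable g) : Computable fun a => f a + g a :=
  Primrec.nat_add.to_comp.comp hf hg

theorem Computable.nat_mul {α : Type*} [Primcodable α] {f g : α → ℕ} (hf : Computable f)
    (hg : Computable g) : Computable fun a => f a * g a :=
  Primrec.nat_mul.to_comp.comp hf hg

theorem Computable.nat_sub {α : Type*} [Primcodable α] {f g : α → ℕ} (hf : Computable f)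
    (hg : Computable g) : Computable fun a => f a - g a :=
  Primrec.nat_sub.to_comp.comp hf hg

theorem Computable.nat_div {α : Type*} [Primcodable α] {f g : α → ℕ} (hf : Computable f)
    (hg : Computable g) : Computable fun a => f a / g a :=
  Primrec.nat_div.to_comp.comp hf hg

theorem Computable.nat_mod {α : Type*} [Primcodable α] {f g : α → ℕ} (hf : Computable f)
    (hg : Computable g) : Computable fun a => f a % g a :=
  Primrec.nat_mod.to_comp.comp hf hg

theorem Computable.two_pow {α : Type*} [Primcodable α] {f : α → ℕ} (hf : Computable f) :
    Computable fun a => 2 ^ f a := by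
  have h : Computable₂ fun (_ : α) (p : ℕ × ℕ) => p.2 * 2 :=
    (Computable.nat_mul (Computable.snd.comp Computable.snd) (Computable.const 2))
  refine (Computable.nat_rec hf (Computable.const 1) h).of_eq fun a => ?_
  generalize f a = n
  induction n with
  | zero => rfl
  | succ n ih => rw [pow_succ, ← ih]

theorem Computable.decide_le {α : Type*} [Primcodable α] {f g : α → ℕ} (hf : Computable f)
    (hg : Computable g) : Computable fun a => decide (f a ≤ g a) :=
  (Primrec.nat_le.decide.to_comp.comp hf hg).of_eq fun a => by congr

theorem Computable.decide_lt {α : Type*} [Primcodable α] {f g : α → ℕ} (hf : Computable f)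
    (hg : Computable g) : Computable fun a => decide (f a < g a) :=
  (Primrec.nat_lt.decide.to_comp.comp hf hg).of_eq fun a => by congr

theorem Computable.decide_eq {α : Type*} [Primcodable α] {f g : α → ℕ} (hf : Computable f)
    (hg : Computable g) : Computable fun a => decide (f a = g a) :=
  (Primrec.eq.decide.to_comp.comp hf hg).of_eq fun a => by congr

theorem Computable.bool_and {α : Type*} [Primcodable α] {f g : α → Bool} (hf : Computable f)
    (hg : Computable g) : Computable fun a => f a && g a :=
  Primrec.and.to_comp.comp hf hg

theorem Computable.bool_toNat {α : Type*} [Primcodable α] {f : α → Bool} (hf : Computable f) :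
    Computable fun a => (f a).toNat :=
  (Computable.cond hf (Computable.const 1) (Computable.const 0)).of_eq fun a => by
    cases f a <;> rfl

/-- Bounded existential quantification preserves decidability. -/
theorem Computable.exists_lt {α : Type*} [Primcodable α] {g : α → ℕ} {f : α → ℕ → Bool}
    (hg : Computable g) (hf : Computable₂ f) :
    Computable fun a => decide (∃ i < g a, f a i = true) := by
  have h : Computable₂ fun a i => (f a i).toNat := Computable.bool_toNat hf
  refine (Computable.decide_lt (Computable.const 0) (Computable.sum_range hg h)).of_eq fun a => ?_
  rw [decide_eq_decide, Finset.sum_pos_iff]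
  refine exists_congr fun i => ?_
  cases h : f a i <;> simp

/-- Unbounded search through a decidable set of naturals is computable. -/
theorem Computable.nat_find {α : Type*} [Primcodable α] {f : α → ℕ → Bool}
    (hf : Computable₂ f) (H : ∀ a, ∃ n, f a n = true) : Computable fun a => Nat.find (H a) := by
  have h := Partrec.rfind (p := fun a => (fun n => Part.some (f a n) : ℕ →. Bool)) hf
  refine Partrec.of_eq_tot h fun a => Nat.mem_rfind.2 ?_
  refine ⟨by simpa using (Nat.find_spec (H a)).symm, fun {m} hm => ?_⟩
  have := Nat.find_min (H a) hm
  simpa using this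

section Rationals

open Encodable Denumerable

/-- The code of a rational number before the codes are compressed to all of `ℕ`. -/
def ratCode (q : ℚ) : ℕ := Nat.pair (Equiv.intEquivNat q.num) q.den

theorem natAbs_intEquivNat_symm (n : ℕ) : (Equiv.intEquivNat.symm n).natAbs = (n + 1) / 2 := by
  obtain ⟨z, rfl⟩ := Equiv.intEquivNat.surjective n
  rw [Equiv.symm_apply_apply]
  cases z with
  | ofNat a => change a = (2 * a + 1) / 2; omega
  | negSucc a => change a + 1 = (2 * a + 1 + 1) / 2; omega

theorem toNat_eq_intEquivNat (z : ℤ) :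
    z.toNat = if Equiv.intEquivNat z % 2 = 0 then Equiv.intEquivNat z / 2 else 0 := by
  cases z with
  | ofNat a => change a = if (2 * a) % 2 = 0 then (2 * a) / 2 else 0; split_ifs <;> omega
  | negSucc a => change 0 = if (2 * a + 1) % 2 = 0 then (2 * a + 1) / 2 else 0; split_ifs <;> omega

theorem mem_range_ratCode (m : ℕ) : m ∈ Set.range ratCode ↔
    0 < m.unpair.2 ∧ ¬ ∃ d < m.unpair.2 + 1,
      2 ≤ d ∧ ((m.unpair.1 + 1) / 2) % d = 0 ∧ m.unpair.2 % d = 0 := by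
  constructor
  · rintro ⟨q, rfl⟩
    simp only [ratCode, Nat.unpair_pair]
    refine ⟨q.pos, ?_⟩
    rintro ⟨d, -, h2, h3, h4⟩
    rw [← natAbs_intEquivNat_symm, Equiv.symm_apply_apply] at h3
    have := Nat.dvd_gcd (Nat.dvd_of_mod_eq_zero h3) (Nat.dvd_of_mod_eq_zero h4)
    rw [q.reduced] at this
    have := Nat.le_of_dvd one_pos this
    omega
  · rintro ⟨hpos, h⟩
    refine ⟨⟨Equiv.intEquivNat.symm m.unpair.1, m.unpair.2, hpos.ne', ?_⟩, ?_⟩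
    · rw [natAbs_intEquivNat_symm]
      by_contra hc
      refine h ⟨_, Nat.lt_succ_of_le (Nat.gcd_le_right _ hpos), ?_,
        Nat.mod_eq_zero_of_dvd (Nat.gcd_dvd_left _ _),
        Nat.mod_eq_zero_of_dvd (Nat.gcd_dvd_right _ _)⟩
      have : 0 < Nat.gcd ((m.unpair.1 + 1) / 2) m.unpair.2 := Nat.gcd_pos_of_pos_right _ hpos
      unfold Nat.Coprime at hc
      omega
    · simp [ratCode]

theorem computable_mem_range_ratCode : Computable fun m => decide (m ∈ Set.range ratCode) := by
  have u1 : Computable fun m : ℕ => m.unpair.1 := Computable.fst.comp Computable.unpair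
  have u2 : Computable fun m : ℕ => m.unpair.2 := Computable.snd.comp Computable.unpair
  have hex := Computable.exists_lt (f := fun m d => decide (2 ≤ d) &&
      (decide (((m.unpair.1 + 1) / 2) % d = 0) && decide (m.unpair.2 % d = 0)))
    (Computable.nat_add u2 (Computable.const 1))
    (Computable.bool_and (Computable.decide_le (Computable.const 2) Computable.snd)
      (Computable.bool_and
        (Computable.decide_eq (Computable.nat_mod (Computable.nat_div (Computable.nat_add
          (u1.comp Computable.fst) (Computable.const 1)) (Computable.const 2)) Computable.snd)
          (Computable.const 0))
        (Computable.decide_eq (Computable.nat_mod (u2.comp Computable.fst) Computable.snd)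
          (Computable.const 0))))
  refine (Computable.bool_and (Computable.decide_lt (Computable.const 0) u2)
    (Primrec.not.to_comp.comp hex)).of_eq fun m => ?_
  rw [Bool.eq_iff_iff]
  simp only [decide_eq_true_eq, mem_range_ratCode]
  simp

theorem ratCode_injective : Function.Injective ratCode := fun a b h =>
  @encode_injective ℚ Rat.instEncodable a b h

theorem exists_add_mem_range_ratCode (m : ℕ) : ∃ n, m + n ∈ Set.range ratCode := by
  obtain ⟨y, hy, hm⟩ := (Set.infinite_range_of_injective ratCode_injective).exists_gt m
  exact ⟨y - m, by rwa [Nat.add_sub_cancel' hm.le]⟩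

/-- The least rational code that is at least `m`. -/
noncomputable def nextRatCode (m : ℕ) : ℕ :=
  m + Nat.find (p := fun n => decide (m + n ∈ Set.range ratCode) = true)
    (by simpa using exists_add_mem_range_ratCode m)

theorem computable_nextRatCode : Computable nextRatCode :=
  Computable.nat_add Computable.id (Computable.nat_find
    (f := fun m n => decide (m + n ∈ Set.range ratCode))
    (computable_mem_range_ratCode.comp (Computable.nat_add Computable.fst Computable.snd)) _)

theorem nextRatCode_mem (m : ℕ) : nextRatCode m ∈ Set.range ratCode := by
  have := Nat.find_spec (p := fun n => decide (m + n ∈ Set.range ratCode) = true)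
    (by simpa using exists_add_mem_range_ratCode m)
  exact of_decide_eq_true this

theorem le_nextRatCode (m : ℕ) : m ≤ nextRatCode m := Nat.le_add_right _ _

theorem nextRatCode_le {m x : ℕ} (h : m ≤ x) (hx : x ∈ Set.range ratCode) :
    nextRatCode m ≤ x := by
  have := Nat.find_min' (p := fun n => decide (m + n ∈ Set.range ratCode) = true)
    (by simpa using exists_add_mem_range_ratCode m) (m := x - m)
    (by rw [Nat.add_sub_cancel' h]; simpa using hx)
  unfold nextRatCode
  omega

theorem ratCode_ofNat : ratCode (ofNat ℚ 0) = nextRatCode 0 ∧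
    ∀ n, ratCode (ofNat ℚ (n + 1)) = nextRatCode (ratCode (ofNat ℚ n) + 1) := by
  let : Encodable ℚ := Rat.instEncodable
  let := decidableRangeEncode ℚ
  have : Infinite (Set.range (@encode ℚ _)) :=
    Infinite.of_injective _ (Equiv.ofInjective _ encode_injective).injective
  let D := Nat.Subtype.denumerable (Set.range (@encode ℚ _))
  have key : ∀ n, ratCode (@ofNat ℚ Rat.instDenumerable n) =
      (Nat.Subtype.ofNat (Set.range (@encode ℚ _)) n).val := by
    intro n
    have h1 : @ofNat ℚ Rat.instDenumerable n =
        (equivRangeEncode ℚ).symm (@ofNat _ D n) := ofEquiv_ofNat _ _ _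
    have h2 : @ofNat _ D n = Nat.Subtype.ofNat (Set.range (@encode ℚ _)) n := by
      exact ofEquiv_ofNat _ _ _
    rw [h1, h2]
    exact congrArg Subtype.val ((equivRangeEncode ℚ).apply_symm_apply _)
  constructor
  · rw [key]
    apply le_antisymm
    · exact bot_le (a := (⟨nextRatCode 0, nextRatCode_mem 0⟩ : Set.range (@encode ℚ _)))
    · exact nextRatCode_le (Nat.zero_le _) (Subtype.property _)
  · intro n
    rw [key, key]
    apply le_antisymm
    · have := Nat.Subtype.succ_le_of_lt (s := Set.range (@encode ℚ _))
        (x := ⟨nextRatCode _, nextRatCode_mem _⟩) (y := Nat.Subtype.ofNat _ n)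
        (Nat.lt_of_succ_le (le_nextRatCode
          ((Nat.Subtype.ofNat (Set.range (@encode ℚ _)) n).val + 1)))
      exact this
    · refine nextRatCode_le ?_ (Subtype.property _)
      exact Nat.Subtype.lt_succ_self (Nat.Subtype.ofNat (Set.range (@encode ℚ _)) n)

theorem computable_ratCode : Computable ratCode := by
  have h : Computable fun n : ℕ => ratCode (ofNat ℚ n) := by
    have step : Computable₂ fun (_ : ℕ) (p : ℕ × ℕ) => nextRatCode (p.2 + 1) :=
      computable_nextRatCode.comp
        (Computable.nat_add (Computable.snd.comp Computable.snd) (Computable.const 1))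
    refine (Computable.nat_rec Computable.id (Computable.const (nextRatCode 0)) step).of_eq
      fun n => ?_
    rw [id]
    induction n with
    | zero => exact ratCode_ofNat.1.symm
    | succ n ih => rw [ratCode_ofNat.2, ← ih]
  exact (h.comp (Computable.encode (α := ℚ))).of_eq fun q => congrArg ratCode (ofNat_encode q)

theorem Rat.computable_den : Computable Rat.den :=
  (Computable.snd.comp (Computable.unpair.comp computable_ratCode)).of_eq fun q => by
    simp [ratCode]

theorem Rat.computable_num_toNat : Computable fun q : ℚ => q.num.toNat := by
  have h : Computable fun q : ℚ => Equiv.intEquivNat q.num :=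
    (Computable.fst.comp (Computable.unpair.comp computable_ratCode)).of_eq fun q => by
      simp [ratCode]
  refine (Computable.cond (Computable.decide_eq (Computable.nat_mod h (Computable.const 2))
    (Computable.const 0)) (Computable.nat_div h (Computable.const 2))
    (Computable.const 0)).of_eq fun q => ?_
  rw [toNat_eq_intEquivNat, Bool.cond_decide]

end Rationals
section Strings

/-- The number with the given binary expansion, most significant digit first. -/
def binVal (σ : List Bool) : ℕ := σ.foldl (fun v b => 2 * v + b.toNat) 0

theorem binVal_concat (σ : List Bool) (b : Bool) :
    binVal (σ ++ [b]) = 2 * binVal σ + b.toNat := by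
  simp [binVal]

theorem binVal_append_bounds (σ τ : List Bool) :
    binVal σ * 2 ^ τ.length ≤ binVal (σ ++ τ) ∧
      binVal (σ ++ τ) + 1 ≤ (binVal σ + 1) * 2 ^ τ.length := by
  induction τ using List.reverseRecOn with
  | nil => simp
  | append_singleton τ b ih =>
    rw [← List.append_assoc, binVal_concat, List.length_append, List.length_singleton, pow_succ]
    have := Bool.toNat_le b
    constructor <;> nlinarith [ih.1, ih.2]

/-- The binary expansion of `v` with `s` digits. -/
def binString : ℕ → ℕ → List Bool
  | 0, _ => []
  | s + 1, v => binString s (v / 2) ++ [decide (v % 2 = 1)]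

theorem length_binString (s v : ℕ) : (binString s v).length = s := by
  induction s generalizing v with
  | zero => rfl
  | succ s ih => simp [binString, ih]

theorem binVal_binString {s v : ℕ} (h : v < 2 ^ s) : binVal (binString s v) = v := by
  induction s generalizing v with
  | zero => simp at h; subst h; rfl
  | succ s ih =>
    rw [binString, binVal_concat, ih (by rw [pow_succ] at h; omega)]
    rcases Nat.mod_two_eq_zero_or_one v with h0 | h0 <;> simp [h0] <;> omega

theorem computable_binVal : Computable binVal := by
  have h : Primrec₂ fun (_ : List Bool) (p : ℕ × Bool) => 2 * p.1 + p.2.toNat := by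
    refine Primrec.nat_add.comp (Primrec.nat_mul.comp (Primrec.const 2)
      (Primrec.fst.comp Primrec.snd)) ?_
    exact (Primrec.dom_finite Bool.toNat).comp (Primrec.snd.comp Primrec.snd)
  exact (Primrec.list_foldl Primrec.id (Primrec.const 0) h).to_comp

end Strings

namespace PFMachine

theorem sum_le_one (M : PFMachine) (F : Finset (List Bool)) (hF : ∀ σ ∈ F, (M.f σ).Dom) :
    ∑ σ ∈ F, (1 / 2 : ℝ) ^ σ.length ≤ 1 := by
  by_cases hnil : [] ∈ F
  · have : F ⊆ {[]} := fun σ hσ => by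
      simpa using (M.prefixFree [] (hF _ hnil) σ (hF _ hσ) (List.nil_prefix)).symm
    refine (Finset.sum_le_sum_of_subset_of_nonneg this fun _ _ _ => by positivity).trans ?_
    simp
  · have hU : InformationTheory.UniquelyDecodable (F : Set (List Bool)) := by
      intro L₁
      induction L₁ with
      | nil =>
        intro L₂ _ h2 he
        cases L₂ with
        | nil => rfl
        | cons w L =>
          have : w = [] := by simp at he; exact he.1
          exact absurd (h2 w (by simp)) (by simpa [this] using hnil)
      | cons v K ih =>
        intro L₂ h1 h2 he
        cases L₂ with
        | nil =>
          have : v = [] := by simp at he; exact he.1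
          exact absurd (h1 v (by simp)) (by simpa [this] using hnil)
        | cons w L =>
          have hv := hF v (by simpa using h1 v (by simp))
          have hw := hF w (by simpa using h2 w (by simp))
          simp only [List.flatten_cons] at he
          have hvw : v = w := by
            rcases List.prefix_or_prefix_of_prefix (List.prefix_append v K.flatten)
              (he ▸ List.prefix_append w L.flatten) with h | h
            · exact M.prefixFree v hv w hw h
            · exact (M.prefixFree w hw v hv h).symm
          subst hvw
          rw [ih L (fun x hx => h1 x (by simp [hx])) (fun x hx => h2 x (by simp [hx]))
            (List.append_cancel_left he)]
    simpa using InformationTheory.kraft_mcmillan_inequality hU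

theorem omegaOf_eq (M : PFMachine) :
    omegaOf M = ∑' σ : {σ : List Bool // (M.f σ).Dom}, (1 / 2 : ℝ) ^ σ.1.length := by
  refine tsum_congr fun σ => ?_
  rw [zpow_neg, zpow_natCast, one_div, inv_pow]

theorem hasSum_omegaOf (M : PFMachine) :
    HasSum (fun σ : {σ : List Bool // (M.f σ).Dom} => (1 / 2 : ℝ) ^ σ.1.length) (omegaOf M) := by
  rw [omegaOf_eq]
  refine (summable_of_sum_le (c := 1) (fun _ => by positivity) fun F => ?_).hasSum
  have := M.sum_le_one (F.map ⟨Subtype.val, Subtype.val_injective⟩) (by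
    intro σ hσ
    obtain ⟨x, -, rfl⟩ := Finset.mem_map.1 hσ
    exact x.2)
  simpa using this

theorem sum_le_omegaOf (M : PFMachine) (F : Finset (List Bool)) (hF : ∀ σ ∈ F, (M.f σ).Dom) :
    ∑ σ ∈ F, (1 / 2 : ℝ) ^ σ.length ≤ omegaOf M := by
  have := sum_le_hasSum (F.subtype fun σ => (M.f σ).Dom) (fun _ _ => by positivity)
    M.hasSum_omegaOf
  rwa [Finset.sum_subtype_of_mem (fun σ => (1 / 2 : ℝ) ^ σ.length) hF] at this

theorem exists_lt_sum_of_lt_omegaOf (M : PFMachine) {x : ℝ} (hx : x < omegaOf M) :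
    ∃ F : Finset (List Bool), (∀ σ ∈ F, (M.f σ).Dom) ∧ x < ∑ σ ∈ F, (1 / 2 : ℝ) ^ σ.length := by
  obtain ⟨F, hF⟩ := (M.hasSum_omegaOf.eventually_const_lt hx).exists
  refine ⟨F.map ⟨Subtype.val, Subtype.val_injective⟩, fun σ hσ => ?_, by simpa using hF⟩
  obtain ⟨y, -, rfl⟩ := Finset.mem_map.1 hσ
  exact y.2

/-- The test deciding the domain of `blockMachine`. -/
def blockTest (a : ℕ → ℕ) (σ : List Bool) : Bool :=
  decide (2 * a (σ.length - 1) ≤ binVal σ) && decide (binVal σ < a σ.length)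

theorem computable_blockTest {a : ℕ → ℕ} (ha : Computable a) : Computable (blockTest a) :=
  Computable.bool_and
    (Computable.decide_le (Computable.nat_mul (Computable.const 2)
      (ha.comp (Computable.nat_sub Computable.list_length (Computable.const 1))))
      computable_binVal)
    (Computable.decide_lt computable_binVal (ha.comp Computable.list_length))

theorem blockTest_prefix {a : ℕ → ℕ} (hmono : ∀ s, 2 * a s ≤ a (s + 1)) {σ τ : List Bool}
    (hσ : blockTest a σ = true) (hτ : blockTest a τ = true) (h : σ <+: τ) : σ = τ := by
  obtain ⟨υ, rfl⟩ := h
  by_contra hne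
  have hυ : υ ≠ [] := fun h0 => hne (by simp [h0])
  obtain ⟨r, hr⟩ : ∃ r, υ.length = r + 1 :=
    Nat.exists_eq_succ_of_ne_zero (by simpa using hυ)
  simp only [blockTest, Bool.and_eq_true, decide_eq_true_eq, List.length_append, hr] at hσ hτ
  have hgrow : ∀ r, a σ.length * 2 ^ r ≤ a (σ.length + r) := by
    intro r
    induction r with
    | zero => simp
    | succ r ih =>
      have := hmono (σ.length + r)
      rw [pow_succ, ← add_assoc]
      nlinarith
  have h1 := (binVal_append_bounds σ υ).2
  have h2 := hgrow r
  have h3 := hτ.1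
  have h4 : (binVal σ + 1) * 2 ^ (r + 1) ≤ a σ.length * 2 ^ (r + 1) :=
    Nat.mul_le_mul_right _ hσ.2
  rw [hr] at h1
  rw [show σ.length + (r + 1) - 1 = σ.length + r by omega] at h3
  rw [pow_succ] at h1 h4
  nlinarith

/-- The machine whose domain contains exactly `a (s + 1) - 2 * a s` strings of length `s + 1`,
occupying consecutive dyadic intervals. -/
def blockMachine (a : ℕ → ℕ) (ha : Computable a) (hmono : ∀ s, 2 * a s ≤ a (s + 1)) :
    PFMachine where
  f σ := bif blockTest a σ then Part.some [] else Part.none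
  partrec := Partrec.cond (computable_blockTest ha) (Computable.const []) Partrec.none
  prefixFree σ hσ τ hτ h := by
    refine blockTest_prefix hmono ?_ ?_ h
    · by_contra hc; simp [Bool.eq_false_iff.2 hc] at hσ
    · by_contra hc; simp [Bool.eq_false_iff.2 hc] at hτ

theorem blockMachine_dom {a : ℕ → ℕ} (ha : Computable a) (hmono : ∀ s, 2 * a s ≤ a (s + 1))
    {σ : List Bool} (h : blockTest a σ = true) : ((blockMachine a ha hmono).f σ).Dom := by
  simp [blockMachine, h]

end PFMachine
section HaltingCount

open Nat.Partrec (Code)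
open Encodable

/-- The string coded by a number, or the empty string. -/
def stringOf (i : ℕ) : List Bool := (decode (α := List Bool) i).getD []

/-- The test whether the code `c` halts within `s` steps on (the code `i` of) a string of length
at most `s`. -/
def haltsBy (c : Code) (s i : ℕ) : Bool :=
  (decide (encode (stringOf i) = i) && decide ((stringOf i).length ≤ s)) && (c.evaln s i).isSome

/-- The scaled stage `s` approximation from below of the halting probability. -/
def haltCount (c : Code) (s : ℕ) : ℕ :=
  ∑ i ∈ Finset.range s, (haltsBy c s i).toNat * 2 ^ (s - (stringOf i).length)

theorem computable_stringOf : Computable stringOf :=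
  (Primrec.option_getD.comp Primrec.decode (Primrec.const [])).to_comp

theorem computable_haltCount (c : Code) : Computable (haltCount c) := by
  have hs : Computable fun p : ℕ × ℕ => stringOf p.2 := computable_stringOf.comp Computable.snd
  have hl : Computable fun p : ℕ × ℕ => (stringOf p.2).length := Computable.list_length.comp hs
  have he : Computable fun p : ℕ × ℕ => (c.evaln p.1 p.2).isSome :=
    Primrec.option_isSome.to_comp.comp (Code.primrec_evaln.to_comp.comp
      (Computable.pair (Computable.pair Computable.fst (Computable.const c)) Computable.snd))
  have hh : Computable fun p : ℕ × ℕ => haltsBy c p.1 p.2 :=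
    Computable.bool_and (Computable.bool_and
      (Computable.decide_eq (Computable.encode.comp hs) Computable.snd)
      (Computable.decide_le hl Computable.fst)) he
  exact Computable.sum_range Computable.id (Computable.nat_mul (Computable.bool_toNat hh)
    (Computable.two_pow (Computable.nat_sub Computable.fst hl)))

/-- The strings counted by `haltCount c s`. -/
noncomputable def haltedStrings (c : Code) (s : ℕ) : Finset (List Bool) :=
  ((Finset.range s).filter fun i => haltsBy c s i = true).image stringOf

theorem mem_haltedStrings {c : Code} {s : ℕ} {σ : List Bool} :
    σ ∈ haltedStrings c s ↔
      encode σ < s ∧ σ.length ≤ s ∧ (c.evaln s (encode σ)).isSome = true := by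
  simp only [haltedStrings, haltsBy, Finset.mem_image, Finset.mem_filter, Finset.mem_range,
    Bool.and_eq_true, decide_eq_true_eq]
  constructor
  · rintro ⟨i, ⟨hi, ⟨hc, hl⟩, he⟩, rfl⟩
    rw [hc]
    exact ⟨hi, hl, he⟩
  · rintro ⟨h1, h2, h3⟩
    have : stringOf (encode σ) = σ := by simp [stringOf]
    exact ⟨encode σ, ⟨h1, ⟨by rw [this], by rwa [this]⟩, h3⟩, this⟩

theorem haltedStrings_mono (c : Code) : Monotone (haltedStrings c) := by
  intro s t hst σ hσ
  rw [mem_haltedStrings] at hσ ⊢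
  refine ⟨hσ.1.trans_le hst, hσ.2.1.trans hst, ?_⟩
  obtain ⟨x, hx⟩ := Option.isSome_iff_exists.1 hσ.2.2
  exact Option.isSome_iff_exists.2 ⟨x, Code.evaln_mono hst hx⟩

theorem sum_haltedStrings (c : Code) (s : ℕ) :
    ∑ σ ∈ haltedStrings c s, (1 / 2 : ℝ) ^ σ.length = haltCount c s / 2 ^ s := by
  rw [haltedStrings, Finset.sum_image, Finset.sum_filter, haltCount, Nat.cast_sum,
    Finset.sum_div]
  · refine Finset.sum_congr rfl fun i _ => ?_
    split_ifs with h
    · have hl : (stringOf i).length ≤ s := by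
        simp only [haltsBy, Bool.and_eq_true, decide_eq_true_eq] at h
        exact h.1.2
      obtain ⟨r, hr⟩ := Nat.exists_eq_add_of_le hl
      rw [h, Bool.toNat_true, one_mul, hr, Nat.add_sub_cancel_left, Nat.cast_pow, pow_add,
        one_div, inv_pow]
      push_cast
      field_simp
    · simp [Bool.eq_false_iff.2 h]
  · intro i hi j hj hij
    simp only [Finset.coe_filter, Set.mem_ofPred_eq, haltsBy, Bool.and_eq_true,
      decide_eq_true_eq] at hi hj
    rw [← hi.2.1.1, ← hj.2.1.1, hij]

theorem two_mul_haltCount_le (c : Code) (s : ℕ) : 2 * haltCount c s ≤ haltCount c (s + 1) := by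
  have h := Finset.sum_le_sum_of_subset_of_nonneg (haltedStrings_mono c (Nat.le_succ s))
    (f := fun σ => (1 / 2 : ℝ) ^ σ.length) (fun _ _ _ => by positivity)
  rw [sum_haltedStrings, sum_haltedStrings, div_le_div_iff₀ (by positivity) (by positivity),
    Nat.succ_eq_add_one, pow_succ] at h
  have h' : (2 * haltCount c s : ℝ) ≤ haltCount c (s + 1) := by
    have h2 : (0 : ℝ) < 2 ^ s := by positivity
    refine le_of_mul_le_mul_right ?_ h2
    linarith
  exact_mod_cast h'

/-- The code `c` computes the machine `M` on codes of strings. -/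
def Computes (c : Code) (M : PFMachine) : Prop :=
  ∀ σ, (M.f σ).Dom ↔ (c.eval (encode σ)).Dom

theorem PFMachine.exists_computes (M : PFMachine) : ∃ c : Code, Computes c M := by
  obtain ⟨c, hc⟩ := Code.exists_code.1 M.partrec
  refine ⟨c, fun σ => ?_⟩
  rw [hc]
  simp

variable {c : Code} {M : PFMachine}

theorem Computes.dom_of_mem (hc : Computes c M) {s : ℕ} {σ : List Bool}
    (h : σ ∈ haltedStrings c s) : (M.f σ).Dom := by
  obtain ⟨x, hx⟩ := Option.isSome_iff_exists.1 (mem_haltedStrings.1 h).2.2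
  exact (hc σ).2 (Part.dom_iff_mem.2 ⟨x, Code.evaln_sound hx⟩)

theorem Computes.eventually_mem (hc : Computes c M) {σ : List Bool} (h : (M.f σ).Dom) :
    ∀ᶠ s in Filter.atTop, σ ∈ haltedStrings c s := by
  obtain ⟨x, hx⟩ := Part.dom_iff_mem.1 ((hc σ).1 h)
  obtain ⟨k, hk⟩ := Code.evaln_complete.1 hx
  filter_upwards [Filter.eventually_ge_atTop (max k (max (encode σ + 1) σ.length))] with s hs
  simp only [max_le_iff] at hs
  exact mem_haltedStrings.2
    ⟨hs.2.1, hs.2.2, Option.isSome_iff_exists.2 ⟨x, Code.evaln_mono hs.1 hk⟩⟩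

theorem Computes.haltCount_le (hc : Computes c M) (s : ℕ) : haltCount c s ≤ 2 ^ s := by
  have h := M.sum_le_one (haltedStrings c s) fun σ hσ => hc.dom_of_mem hσ
  rw [sum_haltedStrings, div_le_one (by positivity)] at h
  exact_mod_cast h

theorem Computes.haltCount_div_le (hc : Computes c M) (s : ℕ) :
    (haltCount c s : ℝ) / 2 ^ s ≤ omegaOf M := by
  rw [← sum_haltedStrings]
  exact M.sum_le_omegaOf _ fun σ hσ => hc.dom_of_mem hσ

theorem Computes.tendsto_haltCount (hc : Computes c M) :
    Filter.Tendsto (fun s => (haltCount c s : ℝ) / 2 ^ s) Filter.atTop (nhds (omegaOf M)) := by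
  refine tendsto_order.2 ⟨fun x hx => ?_, fun x hx =>
    Filter.Eventually.of_forall fun s => (hc.haltCount_div_le s).trans_lt hx⟩
  obtain ⟨F, hF, hxF⟩ := M.exists_lt_sum_of_lt_omegaOf hx
  have : ∀ᶠ s in Filter.atTop, ∀ σ ∈ F, σ ∈ haltedStrings c s :=
    (Filter.eventually_all_finset F).2 fun σ hσ => hc.eventually_mem (hF σ hσ)
  filter_upwards [this] with s hs
  rw [← sum_haltedStrings]
  exact hxF.trans_le (Finset.sum_le_sum_of_subset_of_nonneg hs fun _ _ _ => by positivity)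

/-- Strings that are new in a simulated block machine contribute to the halting probability
on top of what was counted before. -/
theorem Computes.haltCount_add_le (hc : Computes c M) {a : ℕ → ℕ} (ha : Computable a)
    (hmono : ∀ s, 2 * a s ≤ a (s + 1)) (hle : ∀ s, a s ≤ 2 ^ s) {ρ : List Bool}
    (hρ : ∀ σ, M.f (ρ ++ σ) = (PFMachine.blockMachine a ha hmono).f σ) {s t : ℕ} (hst : s ≤ t) :
    (haltCount c s : ℝ) / 2 ^ s + (1 / 2) ^ ρ.length * (a t / 2 ^ t - a s / 2 ^ s) ≤
      omegaOf M := by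
  set P : Finset (Σ _ : ℕ, ℕ) :=
    (Finset.Ico s t).sigma fun u => Finset.Ico (2 * a u) (a (u + 1)) with hP
  set g : (Σ _ : ℕ, ℕ) → List Bool := fun p => ρ ++ binString (p.1 + 1) p.2 with hg
  have hlt : ∀ p ∈ P, p.2 < 2 ^ (p.1 + 1) := fun p hp => by
    simp only [hP, Finset.mem_sigma, Finset.mem_Ico] at hp
    exact hp.2.2.trans_le (hle _)
  have hdom : ∀ σ ∈ P.image g, (M.f σ).Dom := by
    intro σ hσ
    obtain ⟨p, hp, rfl⟩ := Finset.mem_image.1 hσ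
    rw [hg, hρ]
    apply PFMachine.blockMachine_dom
    have hp' := hp
    simp only [hP, Finset.mem_sigma, Finset.mem_Ico] at hp'
    simp [PFMachine.blockTest, length_binString, binVal_binString (hlt p hp), hp'.2.1, hp'.2.2]
  have hdisj : Disjoint (haltedStrings c s) (P.image g) := by
    rw [Finset.disjoint_left]
    intro σ h1 h2
    obtain ⟨p, hp, rfl⟩ := Finset.mem_image.1 h2
    have h3 := (mem_haltedStrings.1 h1).2.1
    simp only [hP, Finset.mem_sigma, Finset.mem_Ico] at hp
    simp only [hg, List.length_append, length_binString] at h3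
    omega
  have hinj : Set.InjOn g P := by
    rintro ⟨u, v⟩ hp ⟨u', v'⟩ hp' h
    have h1 : binString (u + 1) v = binString (u' + 1) v' := List.append_cancel_left h
    have h2 : u = u' := by
      have := congrArg List.length h1
      simpa [length_binString] using this
    subst h2
    have h3 := congrArg binVal h1
    rw [binVal_binString (hlt _ hp), binVal_binString (hlt _ hp')] at h3
    exact Sigma.ext rfl (heq_of_eq h3)
  have hsum := M.sum_le_omegaOf (haltedStrings c s ∪ P.image g) fun σ hσ =>
    (Finset.mem_union.1 hσ).elim hc.dom_of_mem (hdom σ)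
  rw [Finset.sum_union hdisj, sum_haltedStrings, Finset.sum_image hinj, hP,
    Finset.sum_sigma] at hsum
  refine le_of_eq_of_le ?_ hsum
  congr 1
  clear hsum hinj hdisj hdom hlt
  clear_value P
  subst hP
  induction t, hst using Nat.le_induction with
  | base => simp
  | succ t hst ih =>
    rw [Finset.sum_Ico_succ_top hst, ← ih]
    simp only [hg, List.length_append, length_binString, Finset.sum_const, Nat.card_Ico,
      nsmul_eq_mul]
    have hpow : (1 / 2 : ℝ) ^ (t + 1) = 1 / (2 ^ t * 2) := by rw [one_div_pow, pow_succ]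
    rw [Nat.cast_sub (hmono t), pow_add (1 / 2 : ℝ) ρ.length, hpow, pow_succ]
    push_cast
    field_simp
    ring

end HaltingCount
section Cells

/-- The dyadic interval `[j / 2 ^ s, (j + 1) / 2 ^ s)` lies in the positive part of the open
interval `J`, with its left end in the interior. -/
def CellIn (J : ℚ × ℚ) (s j : ℕ) : Prop :=
  J.1.num.toNat * 2 ^ s < j * J.1.den ∧ (j + 1) * J.2.den ≤ J.2.num.toNat * 2 ^ s

theorem cast_toNat_num (q : ℚ) : (q.num.toNat : ℝ) = max (q : ℝ) 0 * q.den := by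
  have h : (q : ℝ) * q.den = q.num := by
    have := Rat.mul_den_eq_num q
    exact_mod_cast congrArg (Rat.cast (K := ℝ)) this
  have hd : (0 : ℝ) ≤ q.den := Nat.cast_nonneg _
  rw [max_mul_of_nonneg _ _ hd, h, zero_mul]
  have : ((q.num.toNat : ℤ) : ℝ) = ((max q.num 0 : ℤ) : ℝ) := by rw [Int.toNat_eq_max]
  push_cast at this
  exact this

theorem cellIn_iff (J : ℚ × ℚ) (s j : ℕ) : CellIn J s j ↔
    max (J.1 : ℝ) 0 < j / 2 ^ s ∧ ((j : ℝ) + 1) / 2 ^ s ≤ max (J.2 : ℝ) 0 := by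
  have h1 : (0 : ℝ) < J.1.den := Nat.cast_pos.2 J.1.pos
  have h2 : (0 : ℝ) < J.2.den := Nat.cast_pos.2 J.2.pos
  have h3 : (0 : ℝ) < 2 ^ s := by positivity
  rw [CellIn, ← Nat.cast_lt (α := ℝ), ← Nat.cast_le (α := ℝ)]
  push_cast
  rw [cast_toNat_num, cast_toNat_num, lt_div_iff₀ h3, div_le_iff₀ h3,
    mul_right_comm, mul_lt_mul_iff_left₀ h1, mul_right_comm, mul_le_mul_iff_left₀ h2]

theorem CellIn.subset {J : ℚ × ℚ} {s j : ℕ} (h : CellIn J s j) :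
    Set.Ico ((j : ℝ) / 2 ^ s) (((j : ℝ) + 1) / 2 ^ s) ⊆ Set.Ioo (J.1 : ℝ) (J.2 : ℝ) := by
  rw [cellIn_iff] at h
  intro x hx
  have h0 : (0 : ℝ) < ((j : ℝ) + 1) / 2 ^ s := by positivity
  refine ⟨(le_max_left _ _).trans_lt (h.1.trans_le hx.1), ?_⟩
  rcases le_max_iff.1 h.2 with h' | h'
  · exact hx.2.trans_le h'
  · exact absurd h' h0.not_ge

theorem CellIn.refine {J : ℚ × ℚ} {s j r i : ℕ} (h : CellIn J s j) (hi : i < 2 ^ r) :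
    CellIn J (s + r) (j * 2 ^ r + i) := by
  obtain ⟨h1, h2⟩ := h
  refine ⟨?_, ?_⟩
  · calc J.1.num.toNat * 2 ^ (s + r) = J.1.num.toNat * 2 ^ s * 2 ^ r := by ring
      _ < j * J.1.den * 2 ^ r := Nat.mul_lt_mul_of_pos_right h1 (by positivity)
      _ = j * 2 ^ r * J.1.den := by ring
      _ ≤ _ := Nat.mul_le_mul_right _ (Nat.le_add_right _ _)
  · calc (j * 2 ^ r + i + 1) * J.2.den ≤ ((j + 1) * 2 ^ r) * J.2.den :=
          Nat.mul_le_mul_right _ (by linarith [Nat.succ_le_of_lt hi])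
      _ = (j + 1) * J.2.den * 2 ^ r := by ring
      _ ≤ J.2.num.toNat * 2 ^ s * 2 ^ r := Nat.mul_le_mul_right _ h2
      _ = _ := by ring

/-- The dyadic intervals of length `2⁻ˢ` found by stage `s` to lie in one of the intervals of `J`
and to be at distance at least `2⁻ˢ` to the left of `N s / 2 ^ s`. -/
noncomputable def cells (J : ℕ → ℚ × ℚ) (N : ℕ → ℕ) (s : ℕ) : Finset ℕ :=
  (Finset.range (2 ^ s)).filter fun j => (∃ k < s, CellIn (J k) s j) ∧ j + 2 ≤ N s

variable {J : ℕ → ℚ × ℚ} {N : ℕ → ℕ}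

theorem mul_two_pow_le (hN : ∀ s, 2 * N s ≤ N (s + 1)) (s r : ℕ) : N s * 2 ^ r ≤ N (s + r) := by
  induction r with
  | zero => simp
  | succ r ih =>
    have := hN (s + r)
    rw [pow_succ, ← add_assoc]
    linarith

/-- The subintervals of length `2⁻⁽ˢ⁺ʳ⁾` of intervals in `cells J N s`. -/
noncomputable def refinedCells (J : ℕ → ℚ × ℚ) (N : ℕ → ℕ) (s r : ℕ) : Finset ℕ :=
  (cells J N s ×ˢ Finset.range (2 ^ r)).image fun p => p.1 * 2 ^ r + p.2

theorem card_refinedCells (J : ℕ → ℚ × ℚ) (N : ℕ → ℕ) (s r : ℕ) :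
    (refinedCells J N s r).card = (cells J N s).card * 2 ^ r := by
  rw [refinedCells, Finset.card_image_of_injOn, Finset.card_product, Finset.card_range]
  rintro ⟨j, i⟩ h ⟨j', i'⟩ h' he
  simp only [Finset.coe_product, Finset.coe_range, Set.mem_prod, Set.mem_Iio] at h h' he
  have hj := congrArg (· / 2 ^ r) he
  have hp : 0 < 2 ^ r := by positivity
  simp only [mul_comm _ (2 ^ r), Nat.mul_add_div hp, Nat.div_eq_of_lt h.2,
    Nat.div_eq_of_lt h'.2, add_zero] at hj
  subst hj
  simpa using he

theorem add_one_le_of_mem_refinedCells {s r i : ℕ} (hi : i ∈ refinedCells J N s r) :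
    i + 1 ≤ (N s - 1) * 2 ^ r := by
  obtain ⟨⟨j, i⟩, h, rfl⟩ := Finset.mem_image.1 hi
  simp only [cells, Finset.mem_product, Finset.mem_filter, Finset.mem_range] at h ⊢
  calc j * 2 ^ r + i + 1 ≤ (j + 1) * 2 ^ r := by linarith [Nat.succ_le_of_lt h.2]
    _ ≤ _ := Nat.mul_le_mul_right _ (by omega)

theorem refinedCells_subset (hN : ∀ s, 2 * N s ≤ N (s + 1)) (s r : ℕ) :
    refinedCells J N s r ⊆ cells J N (s + r) := by
  intro x hx
  have hb := add_one_le_of_mem_refinedCells hx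
  obtain ⟨⟨j, i⟩, h, rfl⟩ := Finset.mem_image.1 hx
  simp only [cells, Finset.mem_product, Finset.mem_filter, Finset.mem_range] at h hb ⊢
  obtain ⟨⟨hj, ⟨k, hk, hc⟩, h2⟩, hi⟩ := h
  refine ⟨?_, ⟨k, by omega, hc.refine hi⟩, ?_⟩
  · calc j * 2 ^ r + i < (j + 1) * 2 ^ r := by linarith
      _ ≤ 2 ^ s * 2 ^ r := Nat.mul_le_mul_right _ hj
      _ = _ := (pow_add _ _ _).symm
  · have h3 := mul_two_pow_le hN s r
    have h4 : 1 ≤ 2 ^ r := Nat.one_le_two_pow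
    obtain ⟨n, hn⟩ : ∃ n, N s = n + 1 := ⟨N s - 1, by omega⟩
    rw [hn] at hb h3
    rw [Nat.add_sub_cancel] at hb
    linarith

theorem card_cells_mul_le (hN : ∀ s, 2 * N s ≤ N (s + 1)) (s r : ℕ) :
    (cells J N s).card * 2 ^ r ≤ (cells J N (s + r)).card := by
  rw [← card_refinedCells]
  exact Finset.card_le_card (refinedCells_subset hN s r)

/-- If the interval `J k` contains everything from `(N s - 1) / 2 ^ s` up to the limit of the
`N t / 2 ^ t`, then all dyadic intervals in this range are found. -/
theorem card_cells_add_le (hN : ∀ s, 2 * N s ≤ N (s + 1)) (hle : ∀ s, N s ≤ 2 ^ s) {s r k : ℕ}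
    (hk : k < s) (h1 : max ((J k).1 : ℝ) 0 < ((N s : ℝ) - 1) / 2 ^ s)
    (h2 : (N (s + r) : ℝ) / 2 ^ (s + r) ≤ (J k).2) :
    ((cells J N s).card : ℝ) / 2 ^ s +
      ((N (s + r) - 1) / 2 ^ (s + r) - (N s - 1) / 2 ^ s) ≤
      (cells J N (s + r)).card / 2 ^ (s + r) := by
  have hNs : 1 < N s := by
    have h0 := (le_max_right ((J k).1 : ℝ) 0).trans_lt h1
    rw [lt_div_iff₀ (by positivity), zero_mul, sub_pos] at h0
    exact_mod_cast h0
  obtain ⟨n, hn⟩ : ∃ n, N s = n + 1 := ⟨N s - 1, by omega⟩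
  have hdisj : Disjoint (refinedCells J N s r) (Finset.Ico (n * 2 ^ r) (N (s + r) - 1)) := by
    rw [Finset.disjoint_left]
    intro i hi hi'
    have := add_one_le_of_mem_refinedCells hi
    rw [hn, Nat.add_sub_cancel] at this
    have := (Finset.mem_Ico.1 hi').1
    omega
  have hsub : refinedCells J N s r ∪ Finset.Ico (n * 2 ^ r) (N (s + r) - 1) ⊆
      cells J N (s + r) := by
    refine Finset.union_subset (refinedCells_subset hN s r) fun i hi => ?_
    rw [Finset.mem_Ico] at hi
    have hle' := hle (s + r)
    simp only [cells, Finset.mem_filter, Finset.mem_range]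
    refine ⟨by omega, ⟨k, by omega, (cellIn_iff _ _ _).2 ⟨h1.trans_le ?_, ?_⟩⟩, by omega⟩
    · rw [hn, div_le_div_iff₀ (by positivity) (by positivity)]
      have : (n : ℝ) * 2 ^ r ≤ i := by exact_mod_cast hi.1
      push_cast
      rw [pow_add]
      calc ((n : ℝ) + 1 - 1) * (2 ^ s * 2 ^ r) = (n * 2 ^ r) * 2 ^ s := by ring
        _ ≤ _ := mul_le_mul_of_nonneg_right this (by positivity)
    · refine le_trans ?_ (h2.trans (le_max_left _ _))
      have : ((i : ℝ) + 1) ≤ N (s + r) := by exact_mod_cast (by omega : i + 1 ≤ N (s + r))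
      exact div_le_div_of_nonneg_right this (by positivity)
  have hcard := Finset.card_le_card hsub
  rw [Finset.card_union_of_disjoint hdisj, card_refinedCells, Nat.card_Ico] at hcard
  have h5 : (cells J N s).card * 2 ^ r + N (s + r) ≤
      (cells J N (s + r)).card + n * 2 ^ r + 1 := by omega
  have h6 : ((cells J N s).card * 2 ^ r + N (s + r) : ℝ) ≤
      (cells J N (s + r)).card + n * 2 ^ r + 1 := by exact_mod_cast h5
  rw [hn, pow_add]
  push_cast
  have h7 : (0 : ℝ) < 2 ^ s * 2 ^ r := by positivity
  rw [le_div_iff₀ h7]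
  have h8 : ((cells J N s).card / 2 ^ s + (((N (s + r) : ℝ) - 1) / (2 ^ s * 2 ^ r) -
      ((n : ℝ) + 1 - 1) / 2 ^ s)) * (2 ^ s * 2 ^ r) =
      (cells J N s).card * 2 ^ r + (N (s + r) - 1) - n * 2 ^ r := by
    field_simp
    ring
  rw [h8]
  linarith

theorem card_cells_le {n : ℕ}
    (hvol : MeasureTheory.volume (⋃ k, Set.Ioo ((J k).1 : ℝ) ((J k).2 : ℝ)) ≤ 2 ^ (-(n : ℤ)))
    (s : ℕ) : ((cells J N s).card : ℝ) / 2 ^ s ≤ 1 / 2 ^ n := by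
  have hsub : (⋃ j ∈ cells J N s, Set.Ico ((j : ℝ) / 2 ^ s) (((j : ℝ) + 1) / 2 ^ s)) ⊆
      ⋃ k, Set.Ioo ((J k).1 : ℝ) ((J k).2 : ℝ) := by
    refine Set.iUnion₂_subset fun j hj => ?_
    simp only [cells, Finset.mem_filter] at hj
    obtain ⟨k, -, hk⟩ := hj.2.1
    exact hk.subset.trans (Set.subset_iUnion_of_subset k subset_rfl)
  have hdisj : (↑(cells J N s) : Set ℕ).PairwiseDisjoint
      fun j : ℕ => Set.Ico ((j : ℝ) / 2 ^ s) (((j : ℝ) + 1) / 2 ^ s) := by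
    have key : ∀ i j : ℕ, i < j → Disjoint (Set.Ico ((i : ℝ) / 2 ^ s) (((i : ℝ) + 1) / 2 ^ s))
        (Set.Ico ((j : ℝ) / 2 ^ s) (((j : ℝ) + 1) / 2 ^ s)) := by
      intro i j hij
      refine Set.disjoint_left.2 fun x hx hx' => ?_
      have : ((i : ℝ) + 1) / 2 ^ s ≤ j / 2 ^ s :=
        div_le_div_of_nonneg_right (by exact_mod_cast hij) (by positivity)
      linarith [hx.2, hx'.1]
    intro i _ j _ hij
    rcases lt_or_gt_of_ne hij with h | h
    · exact key i j h
    · exact (key j i h).symm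
  have hvol' := (MeasureTheory.measure_mono hsub).trans hvol
  rw [MeasureTheory.measure_biUnion_finset hdisj fun _ _ => measurableSet_Ico] at hvol'
  have hone : ∀ j : ℕ, MeasureTheory.volume
      (Set.Ico ((j : ℝ) / 2 ^ s) (((j : ℝ) + 1) / 2 ^ s)) = ENNReal.ofReal (1 / 2 ^ s) := by
    intro j
    rw [Real.volume_Ico]
    congr 1
    ring
  simp only [hone, Finset.sum_const, nsmul_eq_mul] at hvol'
  have hr : (2 : ENNReal) ^ (-(n : ℤ)) = ENNReal.ofReal (1 / 2 ^ n) := by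
    rw [ENNReal.zpow_neg, zpow_natCast, one_div, ENNReal.ofReal_inv_of_pos (by positivity),
      ENNReal.ofReal_pow (by norm_num)]
    simp
  rw [hr, ← ENNReal.ofReal_natCast, ← ENNReal.ofReal_mul (by positivity),
    ENNReal.ofReal_le_ofReal_iff (by positivity)] at hvol'
  rwa [mul_one_div] at hvol'

/-- The computable mass assignment built from a Martin-Löf test: the test of index `2 * d + 2`
is scaled up by the factor `2 ^ (d + 1)`. -/
noncomputable def testMass (I : ℕ → ℕ → ℚ × ℚ) (N : ℕ → ℕ) (s : ℕ) : ℕ :=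
  ∑ d ∈ Finset.range s, 2 ^ (d + 1) * (cells (I (2 * d + 2)) N s).card

theorem computable_decide_cellIn {α : Type*} [Primcodable α] {J : α → ℚ × ℚ} {s j : α → ℕ}
    (hJ : Computable J) (hs : Computable s) (hj : Computable j) :
    Computable fun x => decide (CellIn (J x) (s x) (j x)) := by
  have l := Computable.fst.comp hJ
  have r := Computable.snd.comp hJ
  refine (Computable.bool_and
    (Computable.decide_lt
      (Computable.nat_mul (Rat.computable_num_toNat.comp l) (Computable.two_pow hs))
      (Computable.nat_mul hj (Rat.computable_den.comp l)))
    (Computable.decide_le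
      (Computable.nat_mul (Computable.nat_add hj (Computable.const 1))
        (Rat.computable_den.comp r))
      (Computable.nat_mul (Rat.computable_num_toNat.comp r) (Computable.two_pow hs)))).of_eq
    fun x => ?_
  rw [← Bool.decide_and, decide_eq_decide]
  rfl

theorem computable_testMass {I : ℕ → ℕ → ℚ × ℚ} (hI : Computable₂ I) (hN : Computable N) :
    Computable (testMass I N) := by
  have hcell : Computable₂ fun (p : (ℕ × ℕ) × ℕ) (k : ℕ) =>
      decide (CellIn (I (2 * p.1.2 + 2) k) p.1.1 p.2) := by
    refine computable_decide_cellIn (hI.comp (Computable.nat_add (Computable.nat_mul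
        (Computable.const 2) ?_) (Computable.const 2)) Computable.snd) ?_ ?_
    · exact Computable.snd.comp (Computable.fst.comp Computable.fst)
    · exact Computable.fst.comp (Computable.fst.comp Computable.fst)
    · exact Computable.snd.comp Computable.fst
  have hs : Computable fun p : (ℕ × ℕ) × ℕ => p.1.1 := Computable.fst.comp Computable.fst
  have hmem : Computable₂ fun (p : ℕ × ℕ) (j : ℕ) =>
      (decide (∃ k < p.1, decide (CellIn (I (2 * p.2 + 2) k) p.1 j) = true) &&
        decide (j + 2 ≤ N p.1)).toNat :=
    Computable.bool_toNat (Computable.bool_and (Computable.exists_lt hs hcell)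
      (Computable.decide_le (Computable.nat_add Computable.snd (Computable.const 2))
        (hN.comp hs)))
  have hcard : Computable fun p : ℕ × ℕ => (cells (I (2 * p.2 + 2)) N p.1).card := by
    refine (Computable.sum_range (Computable.two_pow Computable.fst) hmem).of_eq fun p => ?_
    rw [cells, Finset.card_filter]
    refine Finset.sum_congr rfl fun j _ => ?_
    simp only [decide_eq_true_eq]
    rw [← Bool.decide_and]
    split_ifs with h <;> simp [h]
  exact Computable.sum_range Computable.id (Computable.nat_mul (Computable.two_pow
    (Computable.nat_add Computable.snd (Computable.const 1))) hcard)

theorem two_mul_testMass_le (I : ℕ → ℕ → ℚ × ℚ) (hN : ∀ s, 2 * N s ≤ N (s + 1)) (s : ℕ) :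
    2 * testMass I N s ≤ testMass I N (s + 1) := by
  rw [testMass, testMass, Finset.sum_range_succ, Finset.mul_sum]
  refine le_trans (Finset.sum_le_sum fun d _ => ?_) (Nat.le_add_right _ _)
  have := card_cells_mul_le (J := I (2 * d + 2)) hN s 1
  rw [pow_one] at this
  rw [mul_left_comm]
  exact Nat.mul_le_mul_left _ (by linarith)

theorem testMass_le {I : ℕ → ℕ → ℚ × ℚ}
    (hvol : ∀ n : ℕ, MeasureTheory.volume
      (⋃ k, Set.Ioo ((I n k).1 : ℝ) ((I n k).2 : ℝ)) ≤ 2 ^ (-(n : ℤ))) (s : ℕ) :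
    testMass I N s ≤ 2 ^ s := by
  have h1 : ∀ d, (2 : ℝ) ^ (d + 1) * (cells (I (2 * d + 2)) N s).card ≤
      2 ^ s * (1 / 2) ^ (d + 1) := by
    intro d
    have h := card_cells_le (N := N) (hvol (2 * d + 2)) s
    rw [div_le_div_iff₀ (by positivity) (by positivity), one_mul,
      show (2 : ℝ) ^ (2 * d + 2) = 2 ^ (d + 1) * 2 ^ (d + 1) by ring] at h
    rw [one_div_pow, mul_one_div, le_div_iff₀ (by positivity)]
    linarith
  have h2 : ∀ s, ∑ d ∈ Finset.range s, (1 / 2 : ℝ) ^ (d + 1) = 1 - (1 / 2) ^ s := by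
    intro s
    induction s with
    | zero => simp
    | succ s ih => rw [Finset.sum_range_succ, ih]; ring
  have h3 : (testMass I N s : ℝ) ≤ 2 ^ s := by
    rw [testMass]
    push_cast
    refine (Finset.sum_le_sum fun d _ => h1 d).trans ?_
    rw [← Finset.mul_sum, h2]
    have : (0 : ℝ) < (1 / 2) ^ s := by positivity
    have h4 : (0 : ℝ) < 2 ^ s := by positivity
    nlinarith
  exact_mod_cast h3

theorem le_testMass_sub (I : ℕ → ℕ → ℚ × ℚ) (hN : ∀ s, 2 * N s ≤ N (s + 1)) {d s : ℕ}
    (hd : d < s) (r : ℕ) :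
    (2 : ℝ) ^ (d + 1) * ((cells (I (2 * d + 2)) N (s + r)).card / 2 ^ (s + r) -
      (cells (I (2 * d + 2)) N s).card / 2 ^ s) ≤
      testMass I N (s + r) / 2 ^ (s + r) - testMass I N s / 2 ^ s := by
  set g : ℕ → ℝ := fun e => (2 : ℝ) ^ (e + 1) *
    ((cells (I (2 * e + 2)) N (s + r)).card / 2 ^ (s + r) -
      (cells (I (2 * e + 2)) N s).card / 2 ^ s) with hg
  have hg0 : ∀ e, 0 ≤ g e := by
    intro e
    refine mul_nonneg (by positivity) (sub_nonneg.2 ?_)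
    rw [div_le_div_iff₀ (by positivity) (by positivity), pow_add]
    have : ((cells (I (2 * e + 2)) N s).card * 2 ^ r : ℝ) ≤
        (cells (I (2 * e + 2)) N (s + r)).card := by
      exact_mod_cast card_cells_mul_le (J := I (2 * e + 2)) hN s r
    have h2 : (0 : ℝ) < 2 ^ s := by positivity
    nlinarith
  have h1 : g d ≤ ∑ e ∈ Finset.range s, g e :=
    Finset.single_le_sum (fun e _ => hg0 e) (Finset.mem_range.2 hd)
  have h2 : ∑ e ∈ Finset.range s, (2 : ℝ) ^ (e + 1) * (cells (I (2 * e + 2)) N (s + r)).card ≤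
      testMass I N (s + r) := by
    rw [testMass]
    push_cast
    exact Finset.sum_le_sum_of_subset_of_nonneg
      (Finset.range_subset_range.2 (Nat.le_add_right s r)) fun _ _ _ => by positivity
  refine h1.trans ?_
  have h3 : ∑ e ∈ Finset.range s, g e =
      (∑ e ∈ Finset.range s, (2 : ℝ) ^ (e + 1) * (cells (I (2 * e + 2)) N (s + r)).card) /
        2 ^ (s + r) - testMass I N s / 2 ^ s := by
    rw [testMass, Nat.cast_sum, Finset.sum_div, Finset.sum_div, ← Finset.sum_sub_distrib]
    refine Finset.sum_congr rfl fun e _ => ?_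
    rw [hg]
    push_cast
    ring
  rw [h3]
  exact sub_le_sub_right (div_le_div_of_nonneg_right h2 (by positivity)) _

end Cells

theorem UniversalPF.omegaOf_pos {U : PFMachine} (hU : UniversalPF U) : 0 < omegaOf U := by
  obtain ⟨c, hc⟩ := U.exists_computes
  have ha : Computable fun s : ℕ => 2 ^ s / 2 :=
    Computable.nat_div (Computable.two_pow Computable.id) (Computable.const 2)
  have hmono : ∀ s, 2 * (2 ^ s / 2) ≤ 2 ^ (s + 1) / 2 := fun s => by
    rw [pow_succ]
    omega
  obtain ⟨ρ, hρ⟩ := hU (PFMachine.blockMachine _ ha hmono)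
  have h := hc.haltCount_add_le ha hmono (fun s => Nat.div_le_self _ _) hρ (Nat.zero_le 1)
  refine lt_of_lt_of_le ?_ h
  have : (0 : ℝ) < (1 / 2) ^ ρ.length := by positivity
  simp [haltCount]

/-- For every universal prefix-free machine U, the halting probability
Ω_U is Martin-Löf random. -/
theorem stmt_2 (U : PFMachine) (hU : UniversalPF U) : MLRandom (omegaOf U) := by
  intro I hI hvol hmem
  obtain ⟨c, hc⟩ := U.exists_computes
  set N := haltCount c with hNdef
  have hN : ∀ s, 2 * N s ≤ N (s + 1) := two_mul_haltCount_le c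
  obtain ⟨ρ, hρ⟩ := hU (PFMachine.blockMachine (testMass I N)
    (computable_testMass hI (computable_haltCount c)) (two_mul_testMass_le I hN))
  set d := ρ.length with hd
  obtain ⟨k, hk⟩ := Set.mem_iUnion.1 (Set.mem_iInter.1 hmem (2 * d + 2))
  have htend := hc.tendsto_haltCount
  have hpow : Filter.Tendsto (fun s : ℕ => 1 / (2 : ℝ) ^ s) Filter.atTop (nhds 0) := by
    simpa using tendsto_pow_atTop_nhds_zero_of_lt_one (r := (1 / 2 : ℝ)) (by norm_num) (by norm_num)
  have hsub : Filter.Tendsto (fun s => ((N s : ℝ) - 1) / 2 ^ s) Filter.atTop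
      (nhds (omegaOf U)) := by
    simpa [sub_div] using htend.sub hpow
  obtain ⟨s, hs, hks, hds⟩ := ((hsub.eventually_const_lt (max_lt hk.1 hU.omegaOf_pos)).and
    ((Filter.eventually_gt_atTop k).and (Filter.eventually_gt_atTop d))).exists
  have hineq : ∀ r, (N s : ℝ) / 2 ^ s +
      2 * ((N (s + r) - 1) / 2 ^ (s + r) - (N s - 1) / 2 ^ s) ≤ omegaOf U := by
    intro r
    have h1 := hc.haltCount_add_le (computable_testMass hI (computable_haltCount c))
      (two_mul_testMass_le I hN) (testMass_le hvol) hρ (Nat.le_add_right s r)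
    have h2 := le_testMass_sub I hN hds r
    have h3 := card_cells_add_le hN hc.haltCount_le (J := I (2 * d + 2)) (r := r) hks hs
      ((hc.haltCount_div_le _).trans hk.2.le)
    refine le_trans (add_le_add_right ?_ _) h1
    have h4 := (mul_le_mul_of_nonneg_left (le_sub_iff_add_le'.2 h3)
      (by positivity : (0 : ℝ) ≤ 2 ^ (d + 1))).trans h2
    have h5 := mul_le_mul_of_nonneg_left h4 (by positivity : (0 : ℝ) ≤ (1 / 2) ^ d)
    refine le_of_eq_of_le ?_ h5
    rw [← mul_assoc, pow_succ, ← mul_assoc, ← mul_pow]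
    norm_num
  have hlim : Filter.Tendsto (fun r => (N s : ℝ) / 2 ^ s +
      2 * (((N (s + r) : ℝ) - 1) / 2 ^ (s + r) - (N s - 1) / 2 ^ s)) Filter.atTop
      (nhds ((N s : ℝ) / 2 ^ s + 2 * (omegaOf U - (N s - 1) / 2 ^ s))) := by
    have hshift : Filter.Tendsto (fun r => s + r) Filter.atTop Filter.atTop :=
      Filter.tendsto_atTop_mono (fun r => Nat.le_add_left r s) Filter.tendsto_id
    exact (((hsub.comp hshift).sub_const _).const_mul 2).const_add _
  have hfinal := le_of_tendsto' hlim hineq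
  have hle := hc.haltCount_div_le s
  have hpos : (0 : ℝ) < 1 / 2 ^ s := by positivity
  rw [sub_div] at hfinal
  linarith
end
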